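/- arXiv:2103.11711 — 8 statements merged into one kernel-verified Lean document; each statement's English description precedes it below -/
import Mathlib

section
/- Let p ∈ ℕ (p ≥ 1) and 0 ≤ β < 1, and set α = p − β/(1−β) if 0 ≤ β ≤ 1/2, and α = p − (1−β)/β if 1/2 ≤ β < 1. If f ∈ 𝒜_p satisfies f'(z) ≠ 0 for all z ∈ 𝔻 \ {0} and f is p-valent convex of order α, then Re √(f'(z)/(p z^{p−1})) > β for all z ∈ 𝔻. -/
lemma aux_jack (β : ℝ) (hβ1 : β < 1) (s : ℂ → ℂ) (z0 : ℂ) (hz1 : ‖z0‖ < 1) (hz0 : z0 ≠ 0)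
    (hs : DifferentiableOn ℂ s (Metric.ball 0 1)) (hs0 : s 0 = 1)
    (hlt : ∀ z, ‖z‖ < ‖z0‖ → β < (s z).re) (hle : ∀ z, ‖z‖ ≤ ‖z0‖ → β ≤ (s z).re)
    (heq : (s z0).re = β) :
    (z0 * deriv s z0).im = 0 ∧
      2 * (1 - β) * (z0 * deriv s z0).re ≤ -((1 - β) ^ 2 + (s z0).im ^ 2) := by
  have hd : HasDerivAt s (deriv s z0) z0 :=
    (hs.differentiableAt (Metric.isOpen_ball.mem_nhds (by simpa using hz1))).hasDerivAt
  constructor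
  · have h1 : HasDerivAt (fun t : ℝ => z0 * Complex.exp (t * Complex.I)) (z0 * Complex.I) 0 := by
      have h := (((Complex.ofRealCLM.hasDerivAt (x := (0:ℝ))).mul_const Complex.I).cexp).const_mul z0
      simpa using h
    have h2 : HasDerivAt (fun t : ℝ => s (z0 * Complex.exp (t * Complex.I)))
        (deriv s z0 * (z0 * Complex.I)) 0 := by
      have hd' : HasDerivAt s (deriv s z0) (z0 * Complex.exp ((0:ℝ) * Complex.I)) := by
        simpa using hd
      exact hd'.comp (0:ℝ) h1
    have h3 : HasDerivAt (fun t : ℝ => (s (z0 * Complex.exp (t * Complex.I))).re)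
        (deriv s z0 * (z0 * Complex.I)).re 0 :=
      Complex.reCLM.hasFDerivAt.comp_hasDerivAt (0:ℝ) h2
    have hmin : IsLocalMin (fun t : ℝ => (s (z0 * Complex.exp (t * Complex.I))).re) 0 := by
      refine Filter.Eventually.of_forall fun t => ?_
      have := hle (z0 * Complex.exp (t * Complex.I)) (by simp [Complex.norm_exp_ofReal_mul_I])
      simpa [heq] using this
    have h4 := hmin.hasDerivAt_eq_zero h3
    simp only [Complex.mul_re, Complex.mul_im, Complex.I_re, Complex.I_im] at h4 ⊢
    linarith
  · have hr : 0 < ‖z0‖ := norm_pos_iff.2 hz0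
    set c : ℂ := ((2 * β - 1 : ℝ) : ℂ) with hc
    have key : ∀ z, ‖z‖ < ‖z0‖ → ‖s z - 1‖ < ‖s z - c‖ := by
      intro z hz
      have h := hlt z hz
      rw [← sq_lt_sq₀ (norm_nonneg _) (norm_nonneg _), Complex.sq_norm, Complex.sq_norm,
        Complex.normSq_apply, Complex.normSq_apply]
      simp [hc]
      nlinarith
    have hsch : ∀ z, ‖z‖ < ‖z0‖ → ‖s z - 1‖ * ‖z0‖ ≤ ‖z‖ * ‖s z - c‖ := by
      intro z hz
      have hpos : 0 < ‖s z - c‖ := (norm_nonneg _).trans_lt (key z hz)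
      have := Complex.dist_le_div_mul_dist_of_mapsTo_ball (f := fun z => (s z - 1) / (s z - c))
        (c := 0) (R₁ := ‖z0‖) (R₂ := 1) (z := z) ?_ ?_ (by simpa using hz)
      · simp [hs0, dist_eq_norm] at this
        rw [div_le_iff₀ hpos] at this
        calc _ ≤ (‖z0‖⁻¹ * ‖z‖ * ‖s z - c‖) * ‖z0‖ := by gcongr
          _ = _ := by field_simp
      · have hs' := hs.mono (Metric.ball_subset_ball (x := (0:ℂ)) hz1.le)
        refine (hs'.sub_const _).div (hs'.sub_const _) ?_
        intro x hx
        exact norm_pos_iff.1 ((norm_nonneg _).trans_lt (key x (by simpa using hx)))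
      · intro x hx
        have hk := key x (by simpa using hx)
        have hp' := (norm_nonneg _).trans_lt hk
        simp [hs0]
        rw [div_le_one hp']
        exact hk.le
    have h1 : HasDerivAt (fun t : ℝ => (t:ℂ) * z0) z0 1 := by
      simpa using (Complex.ofRealCLM.hasDerivAt (x := (1:ℝ))).mul_const z0
    have h2 : HasDerivAt (fun t : ℝ => s (t * z0)) (deriv s z0 * z0) 1 := by
      have hd' : HasDerivAt s (deriv s z0) (((1:ℝ):ℂ) * z0) := by simpa using hd
      exact hd'.comp (1:ℝ) h1
    have hre : HasDerivAt (fun t : ℝ => (s (t * z0)).re) (deriv s z0 * z0).re 1 :=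
      Complex.reCLM.hasFDerivAt.comp_hasDerivAt (1:ℝ) h2
    have him : HasDerivAt (fun t : ℝ => (s (t * z0)).im) (deriv s z0 * z0).im 1 :=
      Complex.imCLM.hasFDerivAt.comp_hasDerivAt (1:ℝ) h2
    have hh := (((hasDerivAt_id (1:ℝ)).pow 2).mul
      (((hre.sub_const (2*β-1)).pow 2).add (him.pow 2))).sub
      (((hre.sub_const 1).pow 2).add (him.pow 2))
    have hneg : ∀ h : ℝ → ℝ, ∀ h' : ℝ, HasDerivAt h h' 1 → h 1 = 0 →
        (∀ t, 0 < t → t < 1 → 0 ≤ h t) → h' ≤ 0 := by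
      intro h h' hd h0 hpos
      have ht := (hasDerivAt_iff_tendsto_slope.1 hd).mono_left
        (nhdsWithin_mono (1:ℝ) (show Set.Iio (1:ℝ) ⊆ {1}ᶜ from fun x hx => ne_of_lt hx))
      refine le_of_tendsto ht ?_
      filter_upwards [Ioo_mem_nhdsLT (show (0:ℝ) < 1 by norm_num)] with t ht
      rw [slope_def_field, h0, sub_zero]
      exact div_nonpos_of_nonneg_of_nonpos (hpos t ht.1 ht.2) (by linarith [ht.2])
    have := hneg _ _ hh ?_ ?_
    · simp [heq] at this
      rw [mul_comm z0]
      simp only [Complex.mul_re, Complex.mul_im] at *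
      nlinarith
    · simp [heq]; ring
    · intro t ht0 ht1
      have := hsch (t * z0) (by
        simp [abs_of_pos ht0]
        nlinarith)
      simp only [norm_mul, Complex.norm_real, Real.norm_eq_abs, abs_of_pos ht0] at this
      have h5 : ‖s (t * z0) - 1‖ ≤ t * ‖s (t * z0) - c‖ := by nlinarith
      have h6 := pow_le_pow_left₀ (norm_nonneg _) h5 2
      rw [mul_pow, Complex.sq_norm, Complex.sq_norm,
        Complex.normSq_apply, Complex.normSq_apply] at h6
      simp [hc] at h6 ⊢
      nlinarith

/-- Theorem 2.2: if `f ∈ 𝒜_p` is `p`-valent convex of order `α` (with `α` as given in terms of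
`β`), then the branch `s` of `√(f'(z)/(p z^(p-1)))` with `s 0 = 1` satisfies `Re s(z) > β` on
the unit disk. -/
theorem stmt_1 (p : ℕ) (hp : 1 ≤ p) (β α : ℝ) (hβ0 : 0 ≤ β) (hβ1 : β < 1)
    (hα : α = if β ≤ 1 / 2 then (p : ℝ) - β / (1 - β) else (p : ℝ) - (1 - β) / β)
    (f g : ℂ → ℂ) (hg : DifferentiableOn ℂ g (Metric.ball 0 1)) (hg0 : g 0 = 1)
    (hfg : ∀ z ∈ Metric.ball (0 : ℂ) 1, f z = z ^ p * g z)
    (hf' : ∀ z ∈ Metric.ball (0 : ℂ) 1, z ≠ 0 → deriv f z ≠ 0)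
    (hconv : ∀ z ∈ Metric.ball (0 : ℂ) 1, z ≠ 0 →
      α < (1 + z * deriv (deriv f) z / deriv f z).re)
    (s : ℂ → ℂ) (hs : DifferentiableOn ℂ s (Metric.ball 0 1)) (hs0 : s 0 = 1)
    (hs2 : ∀ z ∈ Metric.ball (0 : ℂ) 1, z ≠ 0 →
      (s z) ^ 2 = deriv f z / ((p : ℂ) * z ^ (p - 1))) :
    ∀ z ∈ Metric.ball (0 : ℂ) 1, β < (s z).re := by
  by_contra! hcon
  obtain ⟨z1, hz1, hb1⟩ := hcon
  rw [mem_ball_zero_iff] at hz1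
  have hcont : ContinuousOn s (Metric.closedBall 0 ‖z1‖) :=
    hs.continuousOn.mono (Metric.closedBall_subset_ball hz1)
  have hK : IsCompact (Metric.closedBall (0:ℂ) ‖z1‖ ∩ (fun z => (s z).re) ⁻¹' Set.Iic β) := by
    refine (isCompact_closedBall (0:ℂ) ‖z1‖).of_isClosed_subset ?_ Set.inter_subset_left
    exact (Complex.continuous_re.comp_continuousOn hcont).preimage_isClosed_of_isClosed
      Metric.isClosed_closedBall isClosed_Iic
  obtain ⟨z0, ⟨hz0b, hz0s⟩, hmin⟩ := hK.exists_isMinOn ⟨z1, by simp, hb1⟩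
    (continuous_norm.continuousOn)
  simp only [Set.mem_preimage, Set.mem_Iic] at hz0s
  rw [mem_closedBall_zero_iff] at hz0b
  have hz01 : ‖z0‖ < 1 := hz0b.trans_lt hz1
  have hne : z0 ≠ 0 := by
    rintro rfl
    rw [hs0] at hz0s
    simp at hz0s
    linarith
  have hr : 0 < ‖z0‖ := norm_pos_iff.2 hne
  have hlt : ∀ z, ‖z‖ < ‖z0‖ → β < (s z).re := by
    intro z hz
    by_contra! h
    have : ‖z0‖ ≤ ‖z‖ := hmin ⟨by simpa using hz.le.trans hz0b, h⟩
    linarith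
  have hle : ∀ z, ‖z‖ ≤ ‖z0‖ → β ≤ (s z).re := by
    intro z hz
    have hc1 : ContinuousAt s z := (hs.differentiableAt
      (Metric.isOpen_ball.mem_nhds (by simpa using hz.trans_lt hz01))).continuousAt
    have hc2 : Filter.Tendsto (fun t : ℝ => (s (t * z)).re) (nhdsWithin 1 (Set.Iio 1))
        (nhds (s z).re) := by
      have h1 : Filter.Tendsto (fun t : ℝ => (t:ℂ) * z) (nhdsWithin 1 (Set.Iio 1)) (nhds z) := by
        have : Continuous (fun t : ℝ => (t:ℂ) * z) := by fun_prop
        simpa using (this.tendsto 1).mono_left nhdsWithin_le_nhds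
      exact (Complex.continuous_re.tendsto _).comp (hc1.tendsto.comp h1)
    refine ge_of_tendsto hc2 ?_
    filter_upwards [Ioo_mem_nhdsLT (show (0:ℝ) < 1 by norm_num)] with t ht
    refine (hlt _ ?_).le
    rw [norm_mul, Complex.norm_real, Real.norm_eq_abs, abs_of_pos ht.1]
    nlinarith [ht.1, ht.2, norm_nonneg z]
  have heq := le_antisymm hz0s (hle z0 le_rfl)
  obtain ⟨hDi, hDr⟩ := aux_jack β hβ1 s z0 hz01 hne hs hs0 hlt hle heq
  have hzb : z0 ∈ Metric.ball (0:ℂ) 1 := by simpa using hz01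
  have hp0 : (p:ℂ) ≠ 0 := by exact_mod_cast (by omega : p ≠ 0)
  have hfd : ∀ z ∈ Metric.ball (0:ℂ) 1, z ≠ 0 → deriv f z = p * z ^ (p-1) * s z ^ 2 := by
    intro z hz hz'
    rw [hs2 z hz hz']
    field_simp
  have hS : s z0 ≠ 0 := by
    intro h
    apply hf' z0 hzb hne
    rw [hfd z0 hzb hne, h]; simp
  have hd : HasDerivAt s (deriv s z0) z0 :=
    (hs.differentiableAt (Metric.isOpen_ball.mem_nhds hzb)).hasDerivAt
  have hff : HasDerivAt (deriv f) _ z0 :=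
    (((hasDerivAt_pow (p-1) z0).const_mul (p:ℂ)).mul (hd.pow 2)).congr_of_eventuallyEq (by
      filter_upwards [Metric.isOpen_ball.mem_nhds hzb, isOpen_ne.mem_nhds hne] with z h1 h2
      exact hfd z h1 h2)
  have hc := hconv z0 hzb hne
  have hE : 1 + z0 * deriv (deriv f) z0 / deriv f z0 = p + 2 * (z0 * deriv s z0) / s z0 := by
    rw [hff.deriv, hfd z0 hzb hne]
    obtain ⟨q, rfl⟩ : ∃ q, p = q + 1 := ⟨p - 1, by omega⟩
    rcases q with _ | q
    · simp
      field_simp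
    · simp only [Nat.add_sub_cancel]
      push_cast at hp0 ⊢
      field_simp
      simp
      ring
  rw [hE] at hc
  generalize z0 * deriv s z0 = D at *
  have hN : 0 < β ^ 2 + (s z0).im ^ 2 := by
    have := Complex.normSq_pos.2 hS
    rw [Complex.normSq_apply, heq] at this
    nlinarith
  have hre : ((p:ℂ) + 2 * D / s z0).re = p + 2 * D.re * β / (β ^ 2 + (s z0).im ^ 2) := by
    simp [Complex.div_re, Complex.normSq_apply, heq, hDi]
    ring
  rw [hre] at hc
  generalize (s z0).im = y at *
  generalize D.re = d at *
  have hb : 0 < 1 - β := by linarith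
  split_ifs at hα with hcase
  · have h1 : -β / (1 - β) < 2 * d * β / (β ^ 2 + y ^ 2) := by
      rw [neg_div]; linarith
    rw [div_lt_div_iff₀ hb hN] at h1
    nlinarith [mul_le_mul_of_nonneg_left hDr hβ0, mul_nonneg hβ0 (by linarith : 0 ≤ 1 - 2 * β)]
  · push Not at hcase
    have hβ : 0 < β := by linarith
    have h1 : -(1 - β) / β < 2 * d * β / (β ^ 2 + y ^ 2) := by
      rw [neg_div]; linarith
    rw [div_lt_div_iff₀ hβ hN] at h1
    have h2 := mul_lt_mul_of_pos_left h1 hb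
    have h3 := mul_le_mul_of_nonneg_left hDr (sq_nonneg β)
    have h4 : 0 ≤ (2 * β - 1) * y ^ 2 := mul_nonneg (by linarith) (sq_nonneg y)
    nlinarith
end

section
/- Let p ∈ ℕ (p ≥ 1) and let γ be a real number with (p²+1)/(p+1)² < γ < 1. If f ∈ 𝒜_p satisfies f'(z) ≠ 0 for all z ∈ 𝔻 \ {0} and Re √(f'(z)/(p z^{p−1})) > √(((2p+1)γ − 1)/(2p)) for all z ∈ 𝔻, then Re(f(z)/z^p) > γ for all z ∈ 𝔻 \ {0} (equivalently, the analytic extension g of f(z)/z^p satisfies Re g(z) > γ on 𝔻). -/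
lemma aux_schwarz (q : ℂ → ℂ) (hq : DifferentiableOn ℂ q (Metric.ball 0 1)) (h0 : q 0 = 1)
    (hpos : ∀ z ∈ Metric.ball (0 : ℂ) 1, 0 < (q z).re) (z : ℂ) (hz : ‖z‖ < 1) :
    (1 - (q z).re) ^ 2 + (q z).im ^ 2 ≤ ‖z‖ ^ 2 * ((1 + (q z).re) ^ 2 + (q z).im ^ 2) := by
  have hne : ∀ z ∈ Metric.ball (0 : ℂ) 1, 1 + q z ≠ 0 := by
    intro z hz h
    have h1 := hpos z hz
    have h2 := congrArg Complex.re h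
    simp at h2
    linarith
  have e1 : ∀ w : ℂ, ‖1 - w‖ ^ 2 = (1 - w.re) ^ 2 + w.im ^ 2 := by
    intro w
    rw [Complex.sq_norm, Complex.normSq_apply]; simp; ring
  have e2 : ∀ w : ℂ, ‖1 + w‖ ^ 2 = (1 + w.re) ^ 2 + w.im ^ 2 := by
    intro w
    rw [Complex.sq_norm, Complex.normSq_apply]; simp; ring
  have key : ‖(fun z => (1 - q z) / (1 + q z)) z‖ ≤ ‖z‖ := by
    refine Complex.norm_le_norm_of_mapsTo_ball (R := 1) (f := fun z => (1 - q z) / (1 + q z)) ?_ ?_ ?_ hz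
    · exact ((differentiableOn_const 1).sub hq).div ((differentiableOn_const 1).add hq) hne
    · intro z hz
      simp only [mem_closedBall_zero_iff, norm_div]
      apply div_le_one_of_le₀ _ (norm_nonneg _)
      refine (sq_le_sq₀ (norm_nonneg _) (norm_nonneg _)).1 ?_
      rw [e1, e2]
      nlinarith [hpos z hz]
    · simp [h0]
  have hzb : z ∈ Metric.ball (0 : ℂ) 1 := by simpa using hz
  simp only [norm_div] at key
  rw [div_le_iff₀ (norm_pos_iff.2 (hne z hzb))] at key
  have := pow_le_pow_left₀ (norm_nonneg _) key 2
  rw [mul_pow, e1, e2] at this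
  exact this

lemma aux_jack_s2 (q : ℂ → ℂ) (d : ℂ) (hq : DifferentiableOn ℂ q (Metric.ball 0 1))
    (hd : HasDerivAt q d 1) (h0 : q 0 = 1)
    (hpos : ∀ z ∈ Metric.ball (0 : ℂ) 1, 0 < (q z).re) (h1 : (q 1).re = 0) :
    d.re ≤ -(1 + (q 1).im ^ 2) / 2 := by
  have hd1 : HasDerivAt q d ((1 : ℝ) : ℂ) := by simpa using hd
  have ha : HasDerivAt (fun x : ℝ => (q x).re) d.re 1 := hd1.real_of_complex
  have hb : HasDerivAt (fun x : ℝ => (q x).im) d.im 1 := by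
    have := (hd1.const_mul (-Complex.I)).real_of_complex
    simpa using this
  have hψ := (((hasDerivAt_id (1 : ℝ)).pow 2).mul (((ha.const_add 1).pow 2).add (hb.pow 2))).sub
    (((ha.const_sub 1).pow 2).add (hb.pow 2))
  have ht := (hasDerivAt_iff_tendsto_slope_left_right.1 hψ).1
  have hle := le_of_tendsto (b := 0) ht (by
    have : Set.Ioo (0 : ℝ) 1 ∈ nhdsWithin (1 : ℝ) (Set.Iio 1) := Ioo_mem_nhdsLT one_pos
    filter_upwards [this] with t ht
    have hs := aux_schwarz q hq h0 hpos (t : ℂ) (by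
      rw [Complex.norm_real, Real.norm_of_nonneg ht.1.le]; exact ht.2)
    rw [Complex.norm_real, Real.norm_of_nonneg ht.1.le] at hs
    rw [slope_def_field]
    apply div_nonpos_of_nonneg_of_nonpos
    · simp [h1]; linarith
    · linarith [ht.2])
  simp [h1] at hle
  linarith

lemma aux_tang (q : ℂ → ℂ) (d : ℂ) (hd : HasDerivAt q d 1)
    (hpos : ∀ z : ℂ, ‖z‖ = 1 → 0 ≤ (q z).re) (h1 : (q 1).re = 0) : d.im = 0 := by
  have he : HasDerivAt (fun t : ℂ => Complex.exp (t * Complex.I)) Complex.I ((0 : ℝ) : ℂ) := by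
    have := ((hasDerivAt_id ((0 : ℝ) : ℂ)).mul_const Complex.I).cexp
    simpa using this
  have hc : HasDerivAt (fun t : ℂ => q (Complex.exp (t * Complex.I))) (d * Complex.I)
      ((0 : ℝ) : ℂ) := by
    refine HasDerivAt.comp (h₂ := q) _ ?_ he
    simpa using hd
  have hr := hc.real_of_complex
  have hm : IsLocalMin (fun x : ℝ => (q (Complex.exp (x * Complex.I))).re) 0 := by
    apply Filter.Eventually.of_forall
    intro x
    have := hpos (Complex.exp (x * Complex.I)) (Complex.norm_exp_ofReal_mul_I x)
    simpa [h1] using this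
  have := hm.hasDerivAt_eq_zero hr
  simpa using this

lemma aux_alg (p γ k x a u v c : ℝ) (hp : 0 < p) (hk : 0 < k) (hk' : γ = 1 - k)
    (hc : 0 ≤ c) (hc2 : c ^ 2 = γ - k / (2 * p)) (hcu : c < u) (h2c : p * k ≤ 2 * c ^ 2)
    (ha : a ≤ -(1 + x ^ 2) / 2) (hre : u ^ 2 - v ^ 2 = γ + k * a / p)
    (him : 2 * u * v = k * x) : False := by
  have h1 : k * a / p ≤ k * (-(1 + x ^ 2) / 2) / p := by gcongr
  have h2 : k * (-(1 + x ^ 2) / 2) / p = - (k / (2 * p)) - k * x ^ 2 / (2 * p) := by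
    field_simp; ring
  have h3 : u ^ 2 - c ^ 2 + k * x ^ 2 / (2 * p) ≤ v ^ 2 := by linarith
  have hu : 0 < u := by linarith
  have h4 : c ^ 2 < u ^ 2 := by gcongr
  have h5 : 4 * u ^ 2 * (u ^ 2 - c ^ 2 + k * x ^ 2 / (2 * p)) ≤ (k * x) ^ 2 := by
    rw [← him]; nlinarith [sq_nonneg u]
  have h6 : 0 < 4 * u ^ 2 * (u ^ 2 - c ^ 2) := by
    have : 0 < u ^ 2 - c ^ 2 := by linarith
    positivity
  have h7 : (k * x) ^ 2 ≤ 4 * u ^ 2 * (k * x ^ 2 / (2 * p)) := by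
    have : (k * x) ^ 2 = 2 * (p * k) * (k * x ^ 2 / (2 * p)) := by field_simp
    rw [this]
    apply mul_le_mul_of_nonneg_right _ (by positivity)
    nlinarith
  linarith

/-- Theorem 2.4: if `f ∈ 𝒜_p` is locally `p`-valent with
`Re √(f'(z)/(p z^(p-1))) > √(((2p+1)γ-1)/(2p))` on the disk, where
`(p²+1)/(p+1)² < γ < 1`, then `Re (f(z)/z^p) > γ` on the punctured disk. -/
theorem stmt_2 (p : ℕ) (hp : 1 ≤ p) (γ : ℝ)
    (hγ1 : ((p : ℝ) ^ 2 + 1) / ((p : ℝ) + 1) ^ 2 < γ) (hγ2 : γ < 1)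
    (f g : ℂ → ℂ) (hg : DifferentiableOn ℂ g (Metric.ball 0 1)) (hg0 : g 0 = 1)
    (hfg : ∀ z ∈ Metric.ball (0 : ℂ) 1, f z = z ^ p * g z)
    (hf' : ∀ z ∈ Metric.ball (0 : ℂ) 1, z ≠ 0 → deriv f z ≠ 0)
    (s : ℂ → ℂ) (hs : DifferentiableOn ℂ s (Metric.ball 0 1)) (hs0 : s 0 = 1)
    (hs2 : ∀ z ∈ Metric.ball (0 : ℂ) 1, z ≠ 0 →
      (s z) ^ 2 = deriv f z / ((p : ℂ) * z ^ (p - 1)))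
    (hre : ∀ z ∈ Metric.ball (0 : ℂ) 1,
      Real.sqrt (((2 * (p : ℝ) + 1) * γ - 1) / (2 * (p : ℝ))) < (s z).re) :
    ∀ z ∈ Metric.ball (0 : ℂ) 1, z ≠ 0 → γ < (f z / z ^ p).re := by
  intro z₁ hz₁ hz₁0
  rw [hfg z₁ hz₁, mul_div_cancel_left₀ _ (pow_ne_zero _ hz₁0)]
  by_contra hcon
  push Not at hcon
  have hpR : (0 : ℝ) < p := by exact_mod_cast hp
  have hpC : (p : ℂ) ≠ 0 := by exact_mod_cast hpR.ne'
  have hk : 0 < 1 - γ := by linarith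
  have hkC : ((1 - γ : ℝ) : ℂ) ≠ 0 := by exact_mod_cast hk.ne'
  have hz₁n : ‖z₁‖ < 1 := by simpa using hz₁
  have hsub : Metric.closedBall (0 : ℂ) ‖z₁‖ ⊆ Metric.ball 0 1 :=
    Metric.closedBall_subset_ball hz₁n
  have hcont : ContinuousOn (fun z => (g z).re) (Metric.closedBall (0 : ℂ) ‖z₁‖) :=
    Complex.continuous_re.comp_continuousOn (hg.continuousOn.mono hsub)
  have hcl : IsClosed (Metric.closedBall (0 : ℂ) ‖z₁‖ ∩ (fun z => (g z).re) ⁻¹' Set.Iic γ) :=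
    hcont.preimage_isClosed_of_isClosed Metric.isClosed_closedBall isClosed_Iic
  have hcpt : IsCompact (Metric.closedBall (0 : ℂ) ‖z₁‖ ∩ (fun z => (g z).re) ⁻¹' Set.Iic γ) :=
    (isCompact_closedBall (0 : ℂ) ‖z₁‖).of_isClosed_subset hcl Set.inter_subset_left
  obtain ⟨z₀, ⟨hz₀b, hz₀g⟩, hmin⟩ := hcpt.exists_isMinOn (f := fun z : ℂ => ‖z‖)
    ⟨z₁, by simp, hcon⟩ continuous_norm.continuousOn
  simp only [Set.mem_preimage, Set.mem_Iic] at hz₀g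
  have hz₀1 : z₀ ∈ Metric.ball (0 : ℂ) 1 := hsub hz₀b
  have hz₀n : ‖z₀‖ < 1 := by simpa using hz₀1
  have hz₀0 : z₀ ≠ 0 := by
    rintro rfl
    rw [hg0] at hz₀g
    simp at hz₀g
    linarith
  have hlt : ∀ z : ℂ, ‖z‖ < ‖z₀‖ → γ < (g z).re := by
    intro z hz
    by_contra h
    push Not at h
    have hz' : z ∈ Metric.closedBall (0 : ℂ) ‖z₁‖ := by
      simp at hz₀b ⊢; linarith
    have : ‖z₀‖ ≤ ‖z‖ := hmin ⟨hz', h⟩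
    linarith
  -- on the circle
  have hle : ∀ z : ℂ, ‖z‖ = ‖z₀‖ → γ ≤ (g z).re := by
    intro z hz
    have hzb : z ∈ Metric.ball (0 : ℂ) 1 := by simp [hz, hz₀n]
    have hgc : ContinuousAt g z := (hg.differentiableAt (Metric.isOpen_ball.mem_nhds hzb)).continuousAt
    have hc : Filter.Tendsto (fun t : ℝ => (g ((t : ℂ) * z)).re) (nhdsWithin 1 (Set.Iio 1))
        (nhds (g z).re) := by
      refine (Complex.continuous_re.tendsto _).comp (hgc.tendsto.comp ?_)
      have : Continuous (fun t : ℝ => (t : ℂ) * z) := by fun_prop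
      have h := this.tendsto 1
      simp only [Complex.ofReal_one, one_mul] at h
      exact h.mono_left nhdsWithin_le_nhds
    refine ge_of_tendsto hc ?_
    filter_upwards [Ioo_mem_nhdsLT (one_pos : (0 : ℝ) < 1)] with t ht
    apply (hlt _ _).le
    rw [norm_mul, Complex.norm_real, Real.norm_of_nonneg ht.1.le, hz]
    have : 0 < ‖z₀‖ := norm_pos_iff.2 hz₀0
    nlinarith [ht.2]
  have heq : (g z₀).re = γ := le_antisymm hz₀g (hle z₀ rfl)
  have hgd : HasDerivAt g (deriv g z₀) z₀ :=
    (hg.differentiableAt (Metric.isOpen_ball.mem_nhds hz₀1)).hasDerivAt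
  -- normalized function
  let q : ℂ → ℂ := fun ζ => (g (z₀ * ζ) - (γ : ℂ)) / ((1 - γ : ℝ) : ℂ)
  have hqre : ∀ ζ, (q ζ).re = ((g (z₀ * ζ)).re - γ) / (1 - γ) := by
    intro ζ
    simp only [q, Complex.div_ofReal_re, Complex.sub_re, Complex.ofReal_re]
  have hqim : ∀ ζ, (q ζ).im = (g (z₀ * ζ)).im / (1 - γ) := by
    intro ζ
    simp only [q, Complex.div_ofReal_im, Complex.sub_im, Complex.ofReal_im, sub_zero]
  have hqd : DifferentiableOn ℂ q (Metric.ball 0 1) := by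
    refine ((DifferentiableOn.comp hg (by fun_prop) ?_).sub_const _).div_const _
    intro ζ hζ
    simp at hζ ⊢
    nlinarith [norm_nonneg z₀, norm_nonneg ζ]
  have hqd1 : HasDerivAt q (deriv g z₀ * z₀ / ((1 - γ : ℝ) : ℂ)) 1 := by
    refine ((HasDerivAt.comp (h₂ := g) (h := fun ζ => z₀ * ζ) (1 : ℂ) ?_ ?_).sub_const _).div_const _
    · simpa using hgd
    · simpa using (hasDerivAt_id (1 : ℂ)).const_mul z₀
  have hq0 : q 0 = 1 := by
    simp only [q, mul_zero, hg0]
    rw [div_eq_one_iff_eq hkC]; push_cast; rfl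
  have hqpos : ∀ z ∈ Metric.ball (0 : ℂ) 1, 0 < (q z).re := by
    intro z hz
    rw [hqre]
    apply div_pos _ hk
    have : γ < (g (z₀ * z)).re := by
      apply hlt
      rw [norm_mul]
      have : ‖z‖ < 1 := by simpa using hz
      have : 0 < ‖z₀‖ := norm_pos_iff.2 hz₀0
      nlinarith
    linarith
  have hqnn : ∀ z : ℂ, ‖z‖ = 1 → 0 ≤ (q z).re := by
    intro z hz
    rw [hqre]
    apply div_nonneg _ hk.le
    have := hle (z₀ * z) (by rw [norm_mul, hz, mul_one])
    linarith
  have hq1 : (q 1).re = 0 := by rw [hqre, mul_one, heq]; simp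
  have J1 := aux_jack_s2 q _ hqd hqd1 hq0 hqpos hq1
  have J2 := aux_tang q _ hqd1 hqnn hq1
  -- the equation for s
  have hfd : deriv f z₀ = p * z₀ ^ (p - 1) * g z₀ + z₀ ^ p * deriv g z₀ := by
    have h1 : f =ᶠ[nhds z₀] fun z => z ^ p * g z := by
      filter_upwards [Metric.isOpen_ball.mem_nhds hz₀1] with z hz using hfg z hz
    rw [h1.deriv_eq]
    exact ((hasDerivAt_pow p z₀).mul hgd).deriv
  have hS : (s z₀) ^ 2 = g z₀ + deriv g z₀ * z₀ / p := by
    rw [hs2 z₀ hz₀1 hz₀0, hfd]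
    have : z₀ ^ p = z₀ ^ (p - 1) * z₀ := by rw [← pow_succ, Nat.sub_add_cancel hp]
    rw [this]
    have := pow_ne_zero (p - 1) hz₀0
    field_simp
  have hSre := congrArg Complex.re hS
  have hSim := congrArg Complex.im hS
  have ep : ((p : ℕ) : ℂ) = ((p : ℝ) : ℂ) := by simp
  rw [ep, Complex.add_re, Complex.div_ofReal_re, heq, sq, Complex.mul_re] at hSre
  rw [ep, Complex.add_im, Complex.div_ofReal_im, sq, Complex.mul_im] at hSim
  rw [Complex.div_ofReal_re] at J1
  rw [Complex.div_ofReal_im, div_eq_zero_iff, or_iff_left hk.ne'] at J2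
  rw [J2, zero_div, add_zero] at hSim
  rw [div_lt_iff₀ (by positivity)] at hγ1
  have hc0 : ((2 * (p : ℝ) + 1) * γ - 1) / (2 * (p : ℝ)) = γ - (1 - γ) / (2 * p) := by
    field_simp; ring
  have h2c : p * (1 - γ) ≤ 2 * (((2 * (p : ℝ) + 1) * γ - 1) / (2 * (p : ℝ))) := by
    rw [show 2 * (((2 * (p : ℝ) + 1) * γ - 1) / (2 * (p : ℝ))) =
      ((2 * (p : ℝ) + 1) * γ - 1) / p by field_simp, le_div_iff₀ hpR]
    nlinarith
  have hcn : 0 ≤ ((2 * (p : ℝ) + 1) * γ - 1) / (2 * (p : ℝ)) := by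
    have : 0 < p * (1 - γ) := by positivity
    linarith
  refine aux_alg p γ (1 - γ) (q 1).im _ (s z₀).re (s z₀).im _ hpR hk (by ring)
    (Real.sqrt_nonneg _) (by rw [Real.sq_sqrt hcn, hc0]) (hre z₀ hz₀1)
    (by rw [Real.sq_sqrt hcn]; exact h2c) J1 ?_ ?_
  · rw [mul_div_cancel₀ _ hk.ne']; linarith
  · rw [hqim, mul_one, mul_div_cancel₀ _ hk.ne']; linarith
end

section
/- Let p ∈ ℕ (p ≥ 1). If f ∈ 𝒜_p satisfies f'(z) ≠ 0 for all z ∈ 𝔻 \ {0} and Re √(f'(z)/(p z^{p−1})) > √p/2 for all z ∈ 𝔻, then Re(f(z)/z^p) > 1/2 for all z ∈ 𝔻 \ {0} (equivalently, the analytic extension g of f(z)/z^p satisfies Re g(z) > 1/2 on 𝔻). -/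
lemma jack_aux (w : ℂ → ℂ) (z₀ w' : ℂ) (hz : z₀ ≠ 0)
    (hle : ∀ z, ‖z‖ < ‖z₀‖ → ‖w z‖ ≤ ‖z‖ / ‖z₀‖)
    (hw : HasDerivAt w w' z₀) (h1 : ‖w z₀‖ = 1) :
    ∃ k : ℝ, 1 ≤ k ∧ z₀ * w' = k * w z₀ := by
  have hr : 0 < ‖z₀‖ := norm_pos_iff.mpr hz
  set A : ℂ := (starRingEnd ℂ) (w z₀) * (w' * z₀) with hA
  have key : ∀ τ : ℝ, -A.re - τ * A.im ≤ -1 := by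
    intro τ
    let c : ℂ := ⟨-1, τ⟩
    have hl : HasDerivAt (fun t : ℝ => z₀ * (1 + (t : ℂ) * c)) (z₀ * c) 0 := by
      have h0 : HasDerivAt (fun t : ℝ => (t : ℂ)) 1 0 := Complex.ofRealCLM.hasDerivAt
      simpa using ((h0.mul_const c).const_add 1).const_mul z₀
    have hw0 : HasDerivAt w w' (z₀ * (1 + ((0 : ℝ) : ℂ) * c)) := by simpa using hw
    have hc : HasDerivAt (fun t : ℝ => w (z₀ * (1 + (t : ℂ) * c))) (w' * (z₀ * c)) 0 := by
      exact HasDerivAt.comp (0 : ℝ) hw0 hl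
    have hN := hc.norm_sq
    have hM : HasDerivAt (fun t : ℝ => (1 - t) ^ 2 + t ^ 2 * τ ^ 2) (-2) 0 := by
      have := (((hasDerivAt_id (0 : ℝ)).const_sub 1).pow 2).add
        (((hasDerivAt_id (0 : ℝ)).pow 2).mul_const (τ ^ 2))
      exact this.congr_deriv (by norm_num)
    have hD := hN.sub hM
    have hval : 2 * inner ℝ (w (z₀ * (1 + ((0 : ℝ) : ℂ) * c))) (w' * (z₀ * c))
        = 2 * (-A.re - τ * A.im) := by
      simp only [Complex.inner, hA, c]
      simp
      ring
    rw [hval] at hD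
    have hle0 : 2 * (-A.re - τ * A.im) - -2 ≤ 0 := by
      have ht := hD.hasDerivWithinAt (s := Set.Ioi 0)
      rw [hasDerivWithinAt_iff_tendsto_slope' (by simp)] at ht
      refine le_of_tendsto ht ?_
      have hpos : (0 : ℝ) < 1 / (1 + τ ^ 2) := by positivity
      filter_upwards [Ioo_mem_nhdsGT hpos] with t ht
      have ht0 : 0 < t := ht.1
      have ht1 : t * (1 + τ ^ 2) < 1 := by
        have := ht.2
        rwa [lt_div_iff₀ (by positivity)] at this
      have hn : ‖1 + (t : ℂ) * c‖ ^ 2 = (1 - t) ^ 2 + t ^ 2 * τ ^ 2 := by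
        rw [← Complex.normSq_eq_norm_sq, Complex.normSq_apply]
        simp [c]
        ring
      have hn1 : ‖1 + (t : ℂ) * c‖ < 1 := by
        have : ‖1 + (t : ℂ) * c‖ ^ 2 < 1 := by rw [hn]; nlinarith
        nlinarith [norm_nonneg (1 + (t : ℂ) * c)]
      have hlt : ‖z₀ * (1 + (t : ℂ) * c)‖ < ‖z₀‖ := by
        rw [norm_mul]; nlinarith
      have h2 := hle _ hlt
      rw [norm_mul, mul_div_cancel_left₀ _ hr.ne'] at h2
      have h3 : ‖w (z₀ * (1 + (t : ℂ) * c))‖ ^ 2 ≤ (1 - t) ^ 2 + t ^ 2 * τ ^ 2 := by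
        rw [← hn]; gcongr
      rw [slope_def_field]
      apply div_nonpos_of_nonpos_of_nonneg _ (by linarith)
      simp [h1]
      linarith
    linarith
  have him : A.im = 0 := by
    by_contra h
    have := key (-(A.re + 0) / A.im)
    have h2 : -(A.re + 0) / A.im * A.im = -A.re := by field_simp; ring
    rw [h2] at this
    linarith
  have hre : 1 ≤ A.re := by have := key 0; linarith
  refine ⟨A.re, hre, ?_⟩
  have hAe : (A.re : ℂ) = A := by apply Complex.ext <;> simp [him]
  have hcc : (starRingEnd ℂ) (w z₀) * w z₀ = 1 := by
    rw [mul_comm, Complex.mul_conj, Complex.normSq_eq_norm_sq, h1]; simp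
  rw [hAe, hA]
  linear_combination (-(w' * z₀)) * hcc

lemma norm_sub_one_lt {a : ℂ} : ‖a - 1‖ ^ 2 = ‖a‖ ^ 2 - 2 * (a.re - 1 / 2) := by
  rw [← Complex.normSq_eq_norm_sq, ← Complex.normSq_eq_norm_sq, Complex.normSq_apply,
    Complex.normSq_apply]
  simp
  ring

/-- Theorem 2.5: if `f ∈ 𝒜_p` is locally `p`-valent with
`Re √(f'(z)/(p z^(p-1))) > √p / 2` on the disk, then `Re (f(z)/z^p) > 1/2`
on the punctured disk. -/
theorem stmt_3 (p : ℕ) (hp : 1 ≤ p)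
    (f g : ℂ → ℂ) (hg : DifferentiableOn ℂ g (Metric.ball 0 1)) (hg0 : g 0 = 1)
    (hfg : ∀ z ∈ Metric.ball (0 : ℂ) 1, f z = z ^ p * g z)
    (hf' : ∀ z ∈ Metric.ball (0 : ℂ) 1, z ≠ 0 → deriv f z ≠ 0)
    (s : ℂ → ℂ) (hs : DifferentiableOn ℂ s (Metric.ball 0 1)) (hs0 : s 0 = 1)
    (hs2 : ∀ z ∈ Metric.ball (0 : ℂ) 1, z ≠ 0 →
      (s z) ^ 2 = deriv f z / ((p : ℂ) * z ^ (p - 1)))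
    (hre : ∀ z ∈ Metric.ball (0 : ℂ) 1, Real.sqrt p / 2 < (s z).re) :
    ∀ z ∈ Metric.ball (0 : ℂ) 1, z ≠ 0 → 1 / 2 < (f z / z ^ p).re := by
  intro z₁ hz₁ hz₁0
  rw [hfg z₁ hz₁, mul_div_cancel_left₀ _ (pow_ne_zero _ hz₁0)]
  by_contra hcon
  push Not at hcon
  have hz₁' : ‖z₁‖ < 1 := by simpa using hz₁
  have hsub : Metric.closedBall (0 : ℂ) ‖z₁‖ ⊆ Metric.ball 0 1 :=
    Metric.closedBall_subset_ball hz₁'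
  have hgc : ContinuousOn (fun z => (g z).re) (Metric.closedBall (0 : ℂ) ‖z₁‖) :=
    Complex.continuous_re.comp_continuousOn (hg.continuousOn.mono hsub)
  have hK : IsCompact (Metric.closedBall (0 : ℂ) ‖z₁‖ ∩ (fun z => (g z).re) ⁻¹' Set.Iic (1 / 2)) :=
    (isCompact_closedBall (0 : ℂ) ‖z₁‖).of_isClosed_subset
      (hgc.preimage_isClosed_of_isClosed Metric.isClosed_closedBall isClosed_Iic)
      Set.inter_subset_left
  obtain ⟨z₀, ⟨hz₀b, hz₀g⟩, hmin⟩ := hK.exists_isMinOn ⟨z₁, by simp, hcon⟩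
    continuous_norm.continuousOn
  have hz₀1 : z₀ ∈ Metric.ball (0 : ℂ) 1 := hsub hz₀b
  have hz₀n : ‖z₀‖ ≤ ‖z₁‖ := by simpa using hz₀b
  simp only [Set.mem_preimage, Set.mem_Iic] at hz₀g
  have hz₀ : z₀ ≠ 0 := by
    rintro rfl
    rw [hg0] at hz₀g
    norm_num at hz₀g
  have hr : 0 < ‖z₀‖ := norm_pos_iff.mpr hz₀
  have hin : ∀ z, ‖z‖ < ‖z₀‖ → 1 / 2 < (g z).re := by
    intro z hz
    by_contra h
    push Not at h
    have : ‖z₀‖ ≤ ‖z‖ := hmin ⟨by simpa using (hz.le.trans hz₀n), h⟩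
    linarith
  have hgd : HasDerivAt g (deriv g z₀) z₀ :=
    (hg.differentiableAt (Metric.isOpen_ball.mem_nhds hz₀1)).hasDerivAt
  have hge : (g z₀).re = 1 / 2 := by
    apply le_antisymm hz₀g
    have hcl : z₀ ∈ closure (Metric.ball (0 : ℂ) ‖z₀‖) := by
      rw [closure_ball _ hr.ne']; simp
    have hct : ContinuousWithinAt (fun z => (g z).re) (Metric.ball (0 : ℂ) ‖z₀‖) z₀ :=
      (Complex.continuous_re.continuousAt.comp hgd.continuousAt).continuousWithinAt
    have := mem_closure_iff_nhdsWithin_neBot.mp hcl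
    refine ge_of_tendsto hct ?_
    filter_upwards [self_mem_nhdsWithin] with z hz
    exact (hin z (by simpa using hz)).le
  have hg00 : g z₀ ≠ 0 := by
    intro h; rw [h] at hge; norm_num at hge
  have hgne : ∀ z, ‖z‖ < ‖z₀‖ → g z ≠ 0 := by
    intro z hz h
    have := hin z hz
    rw [h] at this; norm_num at this
  have hz₀lt : ‖z₀‖ < 1 := by linarith
  have hwd : DifferentiableOn ℂ (fun z => (g z - 1) / g z) (Metric.ball 0 ‖z₀‖) := by
    have hg' := hg.mono (Metric.ball_subset_ball hz₀lt.le)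
    exact (hg'.sub_const 1).div hg' (fun z hz => hgne z (by simpa using hz))
  have hwm : Set.MapsTo (fun z => (g z - 1) / g z) (Metric.ball 0 ‖z₀‖) (Metric.ball 0 1) := by
    intro z hz
    have hz' : ‖z‖ < ‖z₀‖ := by simpa using hz
    have h1 := hin z hz'
    have h2 : 0 < ‖g z‖ := norm_pos_iff.mpr (hgne z hz')
    rw [mem_ball_zero_iff, norm_div, div_lt_one h2]
    have := @norm_sub_one_lt (g z)
    nlinarith [norm_nonneg (g z - 1)]
  have hle : ∀ z, ‖z‖ < ‖z₀‖ → ‖(fun z => (g z - 1) / g z) z‖ ≤ ‖z‖ / ‖z₀‖ := by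
    intro z hz
    have h0 : (g 0 - 1) / g 0 = 0 := by simp [hg0]
    have := Complex.dist_le_div_mul_dist_of_mapsTo_ball hwd
      (R₂ := 1) (by
        simp only [h0]; exact hwm.mono_right Metric.ball_subset_closedBall) (z := z) (by simpa using hz)
    simp only [h0, dist_zero_right] at this
    calc _ ≤ _ := this
      _ = _ := by ring
  have hw1 : ‖(fun z => (g z - 1) / g z) z₀‖ = 1 := by
    have h2 : 0 < ‖g z₀‖ := norm_pos_iff.mpr hg00
    have := @norm_sub_one_lt (g z₀)
    rw [hge] at this
    simp only [norm_div]
    rw [div_eq_one_iff_eq h2.ne']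
    exact (sq_eq_sq₀ (norm_nonneg _) (norm_nonneg _)).mp (by linarith)
  obtain ⟨k, hk1, hk⟩ := jack_aux (fun z => (g z - 1) / g z) z₀ _ hz₀ hle
    ((hgd.sub_const 1).div hgd hg00) hw1
  have hkg : z₀ * deriv g z₀ = k * (g z₀ * (g z₀ - 1)) := by
    field_simp at hk
    linear_combination hk
  have hp0 : (p : ℂ) ≠ 0 := by exact_mod_cast (by omega : p ≠ 0)
  have hfd : deriv f z₀ = (p : ℂ) * z₀ ^ (p - 1) * g z₀ + z₀ ^ p * deriv g z₀ := by
    have he : f =ᶠ[nhds z₀] fun z => z ^ p * g z := by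
      filter_upwards [Metric.isOpen_ball.mem_nhds hz₀1] with z hz using hfg z hz
    rw [he.deriv_eq]
    exact ((hasDerivAt_pow p z₀).mul hgd).deriv
  have hs' : (p : ℂ) * (s z₀) ^ 2 = p * g z₀ + k * (g z₀ * (g z₀ - 1)) := by
    have hpow : z₀ ^ p = z₀ ^ (p - 1) * z₀ := by
      rw [← pow_succ]; congr 1; omega
    have hne : z₀ ^ (p - 1) ≠ 0 := pow_ne_zero _ hz₀
    rw [hs2 z₀ hz₀1 hz₀, hfd, hpow, ← hkg]
    field_simp
  have hu := hre z₀ hz₀1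
  set u := (s z₀).re with hudef
  set v := (s z₀).im with hvdef
  set y := (g z₀).im with hy
  have hP : (1 : ℝ) ≤ p := by exact_mod_cast hp
  have e1 := congrArg Complex.re hs'
  have e2 := congrArg Complex.im hs'
  simp [pow_two, ← hudef, ← hvdef, ← hy, hge] at e1 e2
  have hsq : Real.sqrt p ^ 2 = p := Real.sq_sqrt (by linarith)
  have hu2 : (p : ℝ) < 4 * u ^ 2 := by
    nlinarith [Real.sqrt_nonneg (p : ℝ)]
  generalize (p : ℝ) = P at *
  have hyv : y = 2 * (u * v) := by
    have : P * (y - 2 * (u * v)) = 0 := by linarith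
    rcases mul_eq_zero.mp this with h | h <;> linarith
  have e3 : P * (u ^ 2 - v ^ 2) ≤ P / 2 - (y ^ 2 + 1 / 4) := by
    nlinarith [mul_nonneg (sub_nonneg.mpr hk1) (by positivity : 0 ≤ y ^ 2 + 1 / 4)]
  have e4 : P * v ^ 2 ≤ y ^ 2 := by
    rw [hyv]; nlinarith [mul_nonneg (sub_nonneg.mpr hu2.le) (sq_nonneg v)]
  nlinarith [sq_nonneg (P - 1)]
end

section
/- Let p ∈ ℕ (p ≥ 1), 0 ≤ β < p and 0 ≤ b ≤ 2(p−β). Set α = β(1 − 2/(2(p−β)+b)) if 0 ≤ β < p/2, and α = β(1 − 2(p−β)²/(β²(2(p−β)+b))) if p/2 ≤ β < p. If f ∈ 𝒜_{p,b} satisfies f'(z) ≠ 0 and f(z) ≠ 0 for all z ∈ 𝔻 \ {0}, and Re(1 + z f''(z)/f'(z)) > α for all z ∈ 𝔻 \ {0}, then Re(z f'(z)/f(z)) > β for all z ∈ 𝔻 \ {0}. -/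
theorem aux_schwarz_s4 (w : ℂ → ℂ) (hd : DifferentiableOn ℂ w (Metric.ball 0 1))
    (hm : ∀ z ∈ Metric.ball (0:ℂ) 1, ‖w z‖ ≤ 1) (h0 : w 0 = 0) (hA : ‖deriv w 0‖ < 1)
    (z : ℂ) (hz : ‖z‖ < 1) :
    ‖w z‖ * (1 + ‖z‖ * ‖deriv w 0‖) ≤ ‖z‖ * (‖z‖ + ‖deriv w 0‖) := by
  set c := deriv w 0 with hc
  set φ := dslope w 0 with hφ
  have hmaps : Set.MapsTo w (Metric.ball 0 1) (Metric.closedBall (w 0) 1) := by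
    intro y hy
    simpa [h0] using hm y hy
  have hφd : DifferentiableOn ℂ φ (Metric.ball 0 1) :=
    (Complex.differentiableOn_dslope (Metric.ball_mem_nhds _ one_pos)).2 hd
  have hφ1 : ∀ y ∈ Metric.ball (0:ℂ) 1, ‖φ y‖ ≤ 1 := fun y hy => by
    simpa using Complex.norm_dslope_le_div_of_mapsTo_ball hd hmaps hy
  have hφ0 : φ 0 = c := dslope_same _ _
  have hne : ∀ y ∈ Metric.ball (0:ℂ) 1, 1 - (starRingEnd ℂ) c * φ y ≠ 0 := by
    intro y hy h
    have h1 : (starRingEnd ℂ) c * φ y = 1 := (sub_eq_zero.1 h).symm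
    have h2 := congrArg norm h1
    rw [norm_mul, RCLike.norm_conj, norm_one] at h2
    nlinarith [hφ1 y hy, norm_nonneg c, norm_nonneg (φ y)]
  have key : ∀ y, Complex.normSq (φ y - c) = ‖φ y‖^2 + ‖c‖^2 - 2 * ((starRingEnd ℂ) c * φ y).re := by
    intro y
    rw [← Complex.normSq_eq_norm_sq, ← Complex.normSq_eq_norm_sq]
    simp [Complex.normSq_apply]; ring
  have key2 : ∀ y, Complex.normSq (1 - (starRingEnd ℂ) c * φ y)
      = 1 + ‖φ y‖^2 * ‖c‖^2 - 2 * ((starRingEnd ℂ) c * φ y).re := by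
    intro y
    rw [← Complex.normSq_eq_norm_sq, ← Complex.normSq_eq_norm_sq]
    simp [Complex.normSq_apply]; ring
  have hψ := Complex.norm_le_norm_of_mapsTo_ball (R := 1) (z := z)
    (f := fun y => (φ y - c) / (1 - (starRingEnd ℂ) c * φ y)) ?_ ?_ ?_ hz
  · have hzb : z ∈ Metric.ball (0:ℂ) 1 := by simpa using hz
    rw [norm_div, div_le_iff₀ (norm_pos_iff.2 (hne z hzb))] at hψ
    have h2 : ‖φ z - c‖^2 ≤ ‖z‖^2 * ‖1 - (starRingEnd ℂ) c * φ z‖^2 := by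
      rw [← mul_pow]; gcongr
    rw [← Complex.normSq_eq_norm_sq (φ z - c),
      ← Complex.normSq_eq_norm_sq (1 - (starRingEnd ℂ) c * φ z), key, key2] at h2
    have hT : ((starRingEnd ℂ) c * φ z).re ≤ ‖c‖ * ‖φ z‖ := by
      refine (Complex.re_le_norm _).trans ?_
      rw [norm_mul, RCLike.norm_conj]
    have hX := hφ1 z hzb
    set X := ‖φ z‖
    set A := ‖c‖
    set ρ := ‖z‖
    have hX0 : 0 ≤ X := norm_nonneg _
    have hA0 : 0 ≤ A := norm_nonneg _
    have hρ0 : 0 ≤ ρ := norm_nonneg _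
    have hAX : 0 ≤ 1 - A * X := by nlinarith
    have h3 : (X - A)^2 ≤ (ρ * (1 - A * X))^2 := by
      have : 0 ≤ 1 - ρ^2 := by nlinarith
      nlinarith [mul_le_mul_of_nonneg_left hT this]
    have h4 : X - A ≤ ρ * (1 - A * X) :=
      abs_le_of_sq_le_sq' h3 (mul_nonneg hρ0 hAX) |>.2
    have hw : w z = z * φ z := by
      have := sub_smul_dslope w 0 z
      simp only [sub_zero, h0, smul_eq_mul] at this
      exact this.symm
    rw [hw, norm_mul]
    change ρ * X * _ ≤ _
    nlinarith
  · exact (hφd.sub_const c).div ((hφd.const_mul _).const_sub 1) hne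
  · intro y hy
    simp only [Metric.mem_closedBall, dist_zero_right]
    rw [norm_div, div_le_one (norm_pos_iff.2 (hne y hy))]
    rw [← sq_le_sq₀ (norm_nonneg _) (norm_nonneg _), ← Complex.normSq_eq_norm_sq,
      ← Complex.normSq_eq_norm_sq, key, key2]
    have h5 : ‖φ y‖^2 ≤ 1 := by nlinarith [hφ1 y hy, norm_nonneg (φ y)]
    have h6 : ‖c‖^2 ≤ 1 := by nlinarith [norm_nonneg c]
    nlinarith
  · simp [hφ0]

theorem aux_left (u : ℝ → ℝ) (u' : ℝ) (hu : HasDerivAt u u' 1) (h1 : u 1 = 0)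
    (hle : ∀ x, 0 < x → x < 1 → u x ≤ 0) : 0 ≤ u' := by
  have h := (hasDerivAt_iff_tendsto_slope.1 hu).mono_left
    (nhdsWithin_mono 1 (fun x (hx : x < 1) => ne_of_lt hx) : nhdsWithin (1:ℝ) (Set.Iio 1) ≤ _)
  refine ge_of_tendsto h ?_
  have : Set.Ioo (0:ℝ) 1 ∈ nhdsWithin (1:ℝ) (Set.Iio 1) := Ioo_mem_nhdsLT one_pos
  filter_upwards [this] with x hx
  rw [slope_def_field, h1]
  exact div_nonneg_of_nonpos (by linarith [hle x hx.1 hx.2]) (by linarith [hx.2])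

theorem aux_jack_s4 (w : ℂ → ℂ) (d : ℂ) (hd : DifferentiableOn ℂ w (Metric.ball 0 1))
    (hm : ∀ z : ℂ, ‖z‖ ≤ 1 → ‖w z‖ ≤ 1) (h0 : w 0 = 0) (hA : ‖deriv w 0‖ < 1)
    (hd1 : HasDerivAt w d 1) (h1 : ‖w 1‖ = 1) :
    ∃ m : ℝ, 2 / (1 + ‖deriv w 0‖) ≤ m ∧ d = m * w 1 := by
  set A := ‖deriv w 0‖
  have hA0 : 0 ≤ A := norm_nonneg _
  set k := (starRingEnd ℂ) (w 1) with hk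
  have hkw : k * w 1 = 1 := by
    rw [hk, mul_comm, Complex.mul_conj, Complex.normSq_eq_norm_sq, h1]; simp
  have hkn : ‖k‖ = 1 := by rw [hk, RCLike.norm_conj, h1]
  -- radial
  have hrad : 0 ≤ (k * d).re - 2 / (1 + A) := by
    have e1 : HasDerivAt (fun x : ℝ => (k * w x).re) (k * d).re 1 := by
      have : HasDerivAt (fun z => k * w z) (k * d) ((1:ℝ):ℂ) := by
        simpa using hd1.const_mul k
      exact this.real_of_complex
    have e2 : HasDerivAt (fun x : ℝ => x * (x + A) / (1 + x * A)) (2 / (1 + A)) 1 := by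
      have n1 := ((hasDerivAt_id (1:ℝ)).mul ((hasDerivAt_id (1:ℝ)).add_const A)).div
        (((hasDerivAt_id (1:ℝ)).mul_const A).const_add 1) (by simp; positivity)
      refine n1.congr_deriv ?_
      simp; field_simp; ring
    refine aux_left _ _ (e1.sub e2) ?_ ?_
    · simp only [Pi.sub_apply, Complex.ofReal_one, hkw]
      simp [add_comm 1 A, div_self (by positivity : A + 1 ≠ 0)]
    · intro x hx0 hx1
      have hxn : ‖(x:ℂ)‖ = x := by simp [abs_of_pos hx0]
      have h3 := aux_schwarz_s4 w hd (fun z hz => hm z (by simpa using (Metric.mem_ball.1 hz).le)) h0 hA x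
        (by rw [hxn]; exact hx1)
      rw [hxn] at h3
      have h4 : (k * w x).re ≤ ‖w x‖ := by
        refine (Complex.re_le_norm _).trans ?_
        rw [norm_mul, hkn, one_mul]
      have h5 : ‖w x‖ ≤ x * (x + A) / (1 + x * A) := by
        rw [le_div_iff₀ (by positivity)]; exact h3
      simp only [Pi.sub_apply]
      linarith
  have hang : (k * d).im = 0 := by
    have e1 : HasDerivAt (fun x : ℝ => (k * w (Complex.exp (x * Complex.I))).re)
        (k * (d * Complex.I)).re 0 := by
      have e0 : HasDerivAt (fun z : ℂ => Complex.exp (z * Complex.I)) Complex.I ((0:ℝ):ℂ) := by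
        have := ((hasDerivAt_id ((0:ℝ):ℂ)).mul_const Complex.I).cexp
        simpa using this
      have e3 : HasDerivAt (fun z : ℂ => w (Complex.exp (z * Complex.I))) (d * Complex.I) ((0:ℝ):ℂ) := by
        refine HasDerivAt.comp (h₂ := w) _ ?_ e0
        simpa using hd1
      exact (e3.const_mul k).real_of_complex
    have hmax : IsLocalMax (fun x : ℝ => (k * w (Complex.exp (x * Complex.I))).re) 0 := by
      refine Filter.Eventually.of_forall fun x => ?_
      simp only [Complex.ofReal_zero, zero_mul, Complex.exp_zero, hkw, Complex.one_re]
      refine (Complex.re_le_norm _).trans ?_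
      rw [norm_mul, hkn, one_mul]
      exact hm _ (by rw [Complex.norm_exp_ofReal_mul_I])
    have := hmax.hasDerivAt_eq_zero e1
    rw [← mul_assoc, Complex.mul_I_re] at this
    linarith
  refine ⟨(k * d).re, by linarith, ?_⟩
  have : (((k * d).re : ℝ) : ℂ) = k * d := by
    apply Complex.ext <;> simp only [Complex.ofReal_re, Complex.ofReal_im, hang]
  rw [this]
  calc d = (k * w 1) * d := by rw [hkw, one_mul]
    _ = _ := by ring

theorem aux_half (h : ℂ → ℂ) (hd : ∀ z : ℂ, ‖z‖ ≤ 1 → DifferentiableAt ℂ h z)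
    (h0 : h 0 = 1) (hre : ∀ z : ℂ, ‖z‖ ≤ 1 → 0 ≤ (h z).re) (h1 : (h 1).re = 0)
    (hA : ‖deriv h 0‖ < 2) :
    ∃ m : ℝ, 2 / (1 + ‖deriv h 0‖ / 2) ≤ m ∧
      deriv h 1 = ((-(m / 2) * (1 + (h 1).im ^ 2) : ℝ) : ℂ) := by
  have hne : ∀ z : ℂ, ‖z‖ ≤ 1 → h z + 1 ≠ 0 := by
    intro z hz e
    have := congrArg Complex.re e
    simp at this
    linarith [hre z hz]
  have hW : ∀ z : ℂ, ‖z‖ ≤ 1 → HasDerivAt (fun z => (h z - 1) / (h z + 1))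
      (2 * deriv h z / (h z + 1)^2) z := by
    intro z hz
    have := ((hd z hz).hasDerivAt.sub_const 1).div ((hd z hz).hasDerivAt.add_const 1) (hne z hz)
    refine this.congr_deriv ?_
    congr 1; ring
  have hW0 : deriv (fun z => (h z - 1) / (h z + 1)) 0 = deriv h 0 / 2 := by
    rw [(hW 0 (by simp)).deriv, h0]; ring
  have hn : ∀ z : ℂ, Complex.normSq (h z + 1) - Complex.normSq (h z - 1) = 4 * (h z).re := by
    intro z; simp [Complex.normSq_apply]; ring
  have hnA : ‖deriv (fun z => (h z - 1) / (h z + 1)) 0‖ = ‖deriv h 0‖ / 2 := by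
    rw [hW0]; simp
  obtain ⟨m, hm1, hm2⟩ := aux_jack_s4 (fun z => (h z - 1) / (h z + 1)) _
    (fun z hz => (hW z (by simpa using (Metric.mem_ball.1 hz).le)).differentiableAt.differentiableWithinAt)
    (fun z hz => by
      rw [norm_div, div_le_one (norm_pos_iff.2 (hne z hz)),
        ← sq_le_sq₀ (norm_nonneg _) (norm_nonneg _), ← Complex.normSq_eq_norm_sq,
        ← Complex.normSq_eq_norm_sq]
      linarith [hn z, hre z hz]) (by simp [h0]) (by rw [hnA]; linarith) (hW 1 (by simp))
    (by
      have e : Complex.normSq (h 1 - 1) = Complex.normSq (h 1 + 1) := by linarith [hn 1]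
      rw [Complex.normSq_eq_norm_sq, Complex.normSq_eq_norm_sq] at e
      rw [norm_div, (sq_eq_sq₀ (norm_nonneg _) (norm_nonneg _)).1 e, div_self]
      exact norm_ne_zero_iff.2 (hne 1 (by simp)))
  refine ⟨m, by rw [hnA] at hm1; exact hm1, ?_⟩
  have hne1 := hne 1 (by simp)
  have e2 : deriv h 1 = m / 2 * ((h 1 - 1) * (h 1 + 1)) := by
    field_simp at hm2
    linear_combination hm2 / 2
  rw [e2]
  have e3 : h 1 = (h 1).im * Complex.I := by
    apply Complex.ext <;> simp [h1]
  generalize (h 1).im = t at e3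
  rw [e3]
  push_cast
  linear_combination (m / 2 * t^2 : ℂ) * Complex.I_sq

theorem aux_real (p β b α m y : ℝ) (hβ0 : 0 ≤ β) (hβp : β < p)
    (hb0 : 0 ≤ b)
    (hα : α = if β < p / 2 then β * (1 - 2 / (2 * (p - β) + b))
      else β * (1 - 2 * (p - β) ^ 2 / (β ^ 2 * (2 * (p - β) + b))))
    (hm : 4 * (p - β) / (2 * (p - β) + b) ≤ m) (hy : 0 < β ^ 2 + y ^ 2) :
    β + (-(m / 2) * ((p - β) + y ^ 2 / (p - β))) * (β / (β ^ 2 + y ^ 2)) ≤ α := by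
  obtain ⟨P, rfl⟩ : ∃ P, p = P + β := ⟨p - β, by ring⟩
  simp only [add_sub_cancel_right] at *
  have hP : 0 < P := by linarith
  have hm0 : 0 ≤ m := le_trans (by positivity) hm
  rw [hα]
  split_ifs with hlt
  · have h1 : 1 / P ≤ (P + y ^ 2 / P) / (β ^ 2 + y ^ 2) := by
      rw [le_div_iff₀ hy]
      have : P + y ^ 2 / P = 1 / P * (P ^ 2 + y ^ 2) := by field_simp
      rw [this]
      gcongr
      linarith
    have h2 : 4 * P / (2 * P + b) * (1 / P) ≤ m * ((P + y ^ 2 / P) / (β ^ 2 + y ^ 2)) := by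
      gcongr
    have h3 : 4 * P / (2 * P + b) * (1 / P) = 2 * (2 / (2 * P + b)) := by
      field_simp; ring
    have h4 := mul_le_mul_of_nonneg_left h2 hβ0
    rw [h3] at h4
    have h5 : (-(m / 2) * (P + y ^ 2 / P)) * (β / (β ^ 2 + y ^ 2)) =
      - (β * (m * ((P + y ^ 2 / P) / (β ^ 2 + y ^ 2)))) / 2 := by ring
    rw [h5]; linarith
  · have hPβ : P ≤ β := by linarith
    have hβ : 0 < β := by linarith
    have h1 : P / β ^ 2 ≤ (P + y ^ 2 / P) / (β ^ 2 + y ^ 2) := by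
      rw [le_div_iff₀ hy]
      have e : P + y ^ 2 / P - P / β ^ 2 * (β ^ 2 + y ^ 2)
          = y ^ 2 * (β ^ 2 - P ^ 2) / (P * β ^ 2) := by field_simp; ring
      have : 0 ≤ y ^ 2 * (β ^ 2 - P ^ 2) / (P * β ^ 2) := by
        have : 0 ≤ β ^ 2 - P ^ 2 := by nlinarith
        positivity
      linarith
    have h2 : 4 * P / (2 * P + b) * (P / β ^ 2) ≤ m * ((P + y ^ 2 / P) / (β ^ 2 + y ^ 2)) := by
      gcongr
    have h3 : 4 * P / (2 * P + b) * (P / β ^ 2)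
        = 2 * (2 * P ^ 2 / (β ^ 2 * (2 * P + b))) := by
      field_simp; ring
    have h4 := mul_le_mul_of_nonneg_left h2 hβ0
    rw [h3] at h4
    have h5 : (-(m / 2) * (P + y ^ 2 / P)) * (β / (β ^ 2 + y ^ 2)) =
      - (β * (m * ((P + y ^ 2 / P) / (β ^ 2 + y ^ 2)))) / 2 := by ring
    rw [h5]; linarith

/-- first point where `Re q ≤ β`. -/
theorem aux_first (q : ℂ → ℂ) (β : ℝ) (hq : ContinuousOn q (Metric.ball 0 1))
    (h0 : β < (q 0).re) (z : ℂ) (hz : ‖z‖ < 1) (hle : (q z).re ≤ β) :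
    ∃ z₀ : ℂ, z₀ ≠ 0 ∧ ‖z₀‖ < 1 ∧ (q z₀).re = β ∧ ∀ y : ℂ, ‖y‖ ≤ ‖z₀‖ → β ≤ (q y).re := by
  have hsub : Metric.closedBall (0:ℂ) ‖z‖ ⊆ Metric.ball 0 1 := by
    intro y hy
    simp at hy ⊢
    linarith
  have hqr : ContinuousOn (fun y => (q y).re) (Metric.closedBall (0:ℂ) ‖z‖) :=
    Complex.continuous_re.comp_continuousOn (hq.mono hsub)
  have hcl : IsCompact (Metric.closedBall (0:ℂ) ‖z‖ ∩ (fun y => (q y).re) ⁻¹' Set.Iic β) :=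
    (isCompact_closedBall _ _).of_isClosed_subset
      (hqr.preimage_isClosed_of_isClosed Metric.isClosed_closedBall isClosed_Iic)
      Set.inter_subset_left
  obtain ⟨z₀, ⟨hz1, hz2⟩, hmin⟩ := hcl.exists_isMinOn ⟨z, by simp, hle⟩ continuous_norm.continuousOn
  simp only [Set.mem_preimage, Set.mem_Iic] at hz2
  have hz1' : ‖z₀‖ ≤ ‖z‖ := by simpa using hz1
  have hne : z₀ ≠ 0 := by
    rintro rfl
    linarith
  have hlt : ∀ y : ℂ, ‖y‖ < ‖z₀‖ → β < (q y).re := by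
    intro y hy
    by_contra hcon
    have := hmin (a := y) ⟨by simp; linarith, not_lt.1 hcon⟩
    simp only [Set.mem_ofPred_eq] at this
    linarith
  have hall : ∀ y : ℂ, ‖y‖ ≤ ‖z₀‖ → β ≤ (q y).re := by
    intro y hy
    have hy1 : y ∈ closure (Metric.ball (0:ℂ) ‖z₀‖) := by
      rw [closure_ball _ (norm_ne_zero_iff.2 hne)]; simpa using hy
    have hcy : ContinuousWithinAt (fun y => (q y).re) (Metric.ball (0:ℂ) ‖z₀‖) y := by
      refine (hqr y (by simp; linarith)).mono ?_
      intro x hx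
      simp at hx ⊢
      linarith
    exact closure_minimal (s := (fun y => (q y).re) '' Metric.ball (0:ℂ) ‖z₀‖) (t := Set.Ici β)
      (by rintro _ ⟨x, hx, rfl⟩; exact (hlt x (by simpa using hx)).le) isClosed_Ici
      (hcy.mem_closure_image hy1)
  exact ⟨z₀, hne, by linarith, le_antisymm hz2 (hall z₀ le_rfl), hall⟩


/-- Theorem 3.1: for `f ∈ 𝒜_{p,b}` (second coefficient `b`, `0 ≤ b ≤ 2(p-β)`),
`Re(1 + z f''/f') > α` on the punctured disk implies `Re(z f'/f) > β` there,
with `α` as specified. -/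
theorem stmt_4 (p : ℕ) (hp : 1 ≤ p) (β b α : ℝ) (hβ0 : 0 ≤ β) (hβp : β < p)
    (hb0 : 0 ≤ b) (hb1 : b ≤ 2 * ((p : ℝ) - β))
    (hα : α = if β < (p : ℝ) / 2 then β * (1 - 2 / (2 * ((p : ℝ) - β) + b))
      else β * (1 - 2 * ((p : ℝ) - β) ^ 2 / (β ^ 2 * (2 * ((p : ℝ) - β) + b))))
    (f g : ℂ → ℂ) (hg : DifferentiableOn ℂ g (Metric.ball 0 1)) (hg0 : g 0 = 1)
    (hgb : deriv g 0 = (b : ℂ))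
    (hfg : ∀ z ∈ Metric.ball (0 : ℂ) 1, f z = z ^ p * g z)
    (hf' : ∀ z ∈ Metric.ball (0 : ℂ) 1, z ≠ 0 → deriv f z ≠ 0)
    (hfne : ∀ z ∈ Metric.ball (0 : ℂ) 1, z ≠ 0 → f z ≠ 0)
    (hconv : ∀ z ∈ Metric.ball (0 : ℂ) 1, z ≠ 0 →
      α < (1 + z * deriv (deriv f) z / deriv f z).re) :
    ∀ z ∈ Metric.ball (0 : ℂ) 1, z ≠ 0 → β < (z * deriv f z / f z).re := by
  set q : ℂ → ℂ := fun z => p + z * (deriv g z / g z) with hqdef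
  have hball : IsOpen (Metric.ball (0:ℂ) 1) := Metric.isOpen_ball
  have h0b : (0:ℂ) ∈ Metric.ball (0:ℂ) 1 := by simp
  have hgne : ∀ z ∈ Metric.ball (0:ℂ) 1, g z ≠ 0 := by
    intro z hz h
    by_cases hz0 : z = 0
    · rw [hz0, hg0] at h; exact one_ne_zero h
    · apply hfne z hz hz0
      rw [hfg z hz, h, mul_zero]
  have hdg : DifferentiableOn ℂ (deriv g) (Metric.ball 0 1) := hg.deriv hball
  have hquot : DifferentiableOn ℂ (fun z => deriv g z / g z) (Metric.ball 0 1) := hdg.div hg hgne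
  have hq : DifferentiableOn ℂ q (Metric.ball 0 1) :=
    (differentiableOn_id.mul hquot).const_add _
  have hqat : ∀ z ∈ Metric.ball (0:ℂ) 1, HasDerivAt q (deriv q z) z := fun z hz =>
    (hq.differentiableAt (hball.mem_nhds hz)).hasDerivAt
  have hq0 : q 0 = p := by simp [hqdef]
  have hqd0 : deriv q 0 = b := by
    have e := ((hasDerivAt_id (0:ℂ)).mul
      (hquot.differentiableAt (hball.mem_nhds h0b)).hasDerivAt).const_add (p:ℂ)
    have e2 : HasDerivAt q _ 0 := e
    rw [e2.deriv]
    simp [hg0, hgb]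
  -- derivative of f
  have hfd : ∀ z ∈ Metric.ball (0:ℂ) 1, z ≠ 0 → HasDerivAt f (f z * q z / z) z := by
    intro z hz hz0
    have e1 : HasDerivAt (fun z => z ^ p * g z) _ z :=
      (hasDerivAt_pow p z).mul (hg.differentiableAt (hball.mem_nhds hz)).hasDerivAt
    have e2 : f =ᶠ[nhds z] fun z => z ^ p * g z := by
      filter_upwards [hball.mem_nhds hz] with y hy using hfg y hy
    refine (e1.congr_of_eventuallyEq e2).congr_deriv ?_
    rw [hfg z hz]
    have hgz := hgne z hz
    obtain ⟨n, rfl⟩ : ∃ n, p = n + 1 := ⟨p - 1, by omega⟩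
    simp only [hqdef, Nat.add_sub_cancel]
    field_simp
    ring
  have hqz : ∀ z ∈ Metric.ball (0:ℂ) 1, z ≠ 0 → z * deriv f z / f z = q z := by
    intro z hz hz0
    rw [(hfd z hz hz0).deriv]
    have := hfne z hz hz0
    field_simp
  have hqne : ∀ z ∈ Metric.ball (0:ℂ) 1, z ≠ 0 → q z ≠ 0 := by
    intro z hz hz0 h
    apply hf' z hz hz0
    rw [(hfd z hz hz0).deriv, h]; simp
  have hcv : ∀ z ∈ Metric.ball (0:ℂ) 1, z ≠ 0 →
      1 + z * deriv (deriv f) z / deriv f z = q z + z * deriv q z / q z := by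
    intro z hz hz0
    have e1 : HasDerivAt (fun z => f z * q z / z) _ z :=
      ((hfd z hz hz0).mul (hqat z hz)).div (hasDerivAt_id z) hz0
    have e2 : deriv f =ᶠ[nhds z] fun z => f z * q z / z := by
      filter_upwards [hball.mem_nhds hz, isOpen_ne.mem_nhds hz0] with y hy hy0
      exact (hfd y hy hy0).deriv
    rw [(e1.congr_of_eventuallyEq e2).deriv, (hfd z hz hz0).deriv]
    have h1 := hfne z hz hz0
    have h2 := hqne z hz hz0
    simp only [Pi.mul_apply, id]
    field_simp
    ring
  intro z hz hz0
  rw [hqz z hz hz0]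
  by_contra hcon
  obtain ⟨z₀, hz₀, hz₀1, hre, hall⟩ := aux_first q β hq.continuousOn (by simpa [hq0] using hβp) z
    (by simpa using hz) (not_lt.1 hcon)
  have hz₀b : z₀ ∈ Metric.ball (0:ℂ) 1 := by simpa using hz₀1
  have hP : 0 < (p:ℝ) - β := by linarith
  have hPc : (p:ℂ) - β ≠ 0 := by exact_mod_cast hP.ne'
  have hH : ∀ s : ℂ, ‖s‖ ≤ 1 → HasDerivAt (fun s => (q (z₀ * s) - β) / (p - β))
      (deriv q (z₀ * s) * z₀ / (p - β)) s := by
    intro s hs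
    have hb : z₀ * s ∈ Metric.ball (0:ℂ) 1 := by
      simp only [Metric.mem_ball, dist_zero_right, norm_mul]
      nlinarith [norm_nonneg z₀, norm_nonneg s]
    have e : HasDerivAt (fun s => z₀ * s) z₀ s := by
      simpa using (hasDerivAt_id s).const_mul z₀
    exact ((HasDerivAt.comp (h₂ := q) s (hqat _ hb) e).sub_const _).div_const _
  have hcast : ((p:ℂ) - β) = (((p:ℝ) - β : ℝ) : ℂ) := by push_cast; rfl
  have hHre : ∀ s : ℂ, ((q (z₀ * s) - β) / (p - β)).re = ((q (z₀ * s)).re - β) / (p - β) := by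
    intro s
    rw [hcast, Complex.div_ofReal_re]; simp
  have hn0 : ‖deriv (fun s => (q (z₀ * s) - β) / (p - β)) 0‖ = ‖z₀‖ * (b / (p - β)) := by
    rw [(hH 0 (by simp)).deriv, mul_zero, hqd0, hcast, norm_div, norm_mul, Complex.norm_real,
      Complex.norm_real, Real.norm_of_nonneg hb0, Real.norm_of_nonneg hP.le]
    ring
  have hbP : b / (p - β) ≤ 2 := by rw [div_le_iff₀ hP]; exact hb1
  have hbP0 : 0 ≤ b / (p - β) := by positivity
  obtain ⟨m, hm1, hm2⟩ := aux_half (fun s => (q (z₀ * s) - β) / (p - β))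
    (fun s hs => (hH s hs).differentiableAt) (by simp [hq0, div_self hPc])
    (fun s hs => by
      rw [hHre]
      refine div_nonneg ?_ hP.le
      have := hall (z₀ * s) (by rw [norm_mul]; nlinarith [norm_nonneg z₀])
      linarith)
    (by rw [hHre, mul_one, hre]; simp)
    (by rw [hn0]; nlinarith [norm_nonneg z₀])
  rw [hn0] at hm1
  have hm3 : 4 * ((p:ℝ) - β) / (2 * (p - β) + b) ≤ m := by
    refine le_trans ?_ hm1
    have e : 4 * ((p:ℝ) - β) / (2 * (p - β) + b) = 2 / (1 + 1 * (b / (p - β)) / 2) := by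
      field_simp; ring
    rw [e]
    have := norm_nonneg z₀
    gcongr
  rw [(hH 1 (by simp)).deriv] at hm2
  simp only [mul_one] at hm2
  set y := (q z₀).im with hy
  have him : ((q z₀ - β) / (p - β)).im = y / (p - β) := by
    rw [hcast, Complex.div_ofReal_im]; simp [hy]
  rw [him] at hm2
  have hD : z₀ * deriv q z₀ = ((-(m / 2) * ((p - β) + y ^ 2 / (p - β)) : ℝ) : ℂ) := by
    rw [div_eq_iff hPc] at hm2
    rw [mul_comm, hm2, hcast, ← Complex.ofReal_mul]
    congr 1
    field_simp
  have hqne0 := hqne z₀ hz₀b hz₀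
  have hns : Complex.normSq (q z₀) = β ^ 2 + y ^ 2 := by
    rw [Complex.normSq_apply, hre, ← hy]; ring
  have hpos : 0 < β ^ 2 + y ^ 2 := by rw [← hns]; exact Complex.normSq_pos.2 hqne0
  have hfin := aux_real p β b α m y hβ0 hβp hb0 hα hm3 hpos
  have hc := hconv z₀ hz₀b hz₀
  rw [hcv z₀ hz₀b hz₀, hD, Complex.add_re, hre, div_eq_mul_inv, Complex.re_ofReal_mul,
    Complex.inv_re, hre, hns] at hc
  linarith
end

section
/- Let p ∈ ℕ (p ≥ 1) and 0 ≤ b ≤ p. If f ∈ 𝒜_{p,b} satisfies f'(z) ≠ 0 and f(z) ≠ 0 for all z ∈ 𝔻 \ {0}, and Re(1 + z f''(z)/f'(z)) > (p/2)(1 − 2/(p+b)) for all z ∈ 𝔻 \ {0}, then Re(z f'(z)/f(z)) > p/2 for all z ∈ 𝔻 \ {0}. -/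
open Metric Filter Topology

lemma aux_id (a h : ℂ) : ‖1 - (starRingEnd ℂ) a * h‖ ^ 2 - ‖h - a‖ ^ 2
    = (1 - ‖h‖ ^ 2) * (1 - ‖a‖ ^ 2) := by
  simp only [← Complex.normSq_eq_norm_sq, Complex.normSq_apply]
  simp
  ring

lemma aux_sp (h : ℂ → ℂ) (hd : DifferentiableOn ℂ h (ball 0 1))
    (hb : ∀ z ∈ ball (0:ℂ) 1, ‖h z‖ ≤ 1) (z : ℂ) (hz : z ∈ ball (0:ℂ) 1) :
    ‖h z‖ * (1 + ‖h 0‖ * ‖z‖) ≤ ‖z‖ + ‖h 0‖ := by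
  have h0 : ‖h 0‖ ≤ 1 := hb 0 (by simp)
  have hz1 : ‖z‖ < 1 := by simpa using hz
  have ht := hb z hz
  rcases h0.lt_or_eq with h1 | h1
  swap
  · rw [h1]; nlinarith [norm_nonneg z]
  have hne : ∀ u ∈ ball (0:ℂ) 1, 0 < ‖1 - (starRingEnd ℂ) (h 0) * h u‖ ∧
      1 - ‖h 0‖ * ‖h u‖ ≤ ‖1 - (starRingEnd ℂ) (h 0) * h u‖ := by
    intro u hu
    have := norm_sub_norm_le (1:ℂ) ((starRingEnd ℂ) (h 0) * h u)
    simp only [norm_one, norm_mul, RCLike.norm_conj] at this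
    refine ⟨?_, this⟩
    nlinarith [hb u hu, norm_nonneg (h u), norm_nonneg (h 0)]
  have key := Complex.norm_le_norm_of_mapsTo_ball (R := 1) (z := z)
    (f := fun u => (h u - h 0) / (1 - (starRingEnd ℂ) (h 0) * h u)) ?_ ?_ (by simp) hz1
  · rw [norm_div, div_le_iff₀ (hne z hz).1] at key
    have id1 := aux_id (h 0) (h z)
    have hD := (hne z hz).2
    set D := ‖1 - (starRingEnd ℂ) (h 0) * h z‖
    set t := ‖h z‖
    set α := ‖h 0‖
    set x := ‖z‖
    have hα : 0 ≤ α := norm_nonneg _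
    have ht0 : 0 ≤ t := norm_nonneg _
    have hx0 : 0 ≤ x := norm_nonneg _
    have e1 : ‖h z - h 0‖ ^ 2 ≤ (x * D) ^ 2 := pow_le_pow_left₀ (norm_nonneg _) key 2
    have e2 : 0 ≤ 1 - α * t := by nlinarith
    have e3 : (1 - α * t) ^ 2 ≤ D ^ 2 := pow_le_pow_left₀ e2 hD 2
    have e4 : (1 - x^2) * (1 - α * t) ^ 2 ≤ (1 - x^2) * D ^ 2 :=
      mul_le_mul_of_nonneg_left e3 (by nlinarith)
    have e5 : (t - α) ^ 2 ≤ (x * (1 - α * t)) ^ 2 := by nlinarith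
    have e6 := abs_le_of_sq_le_sq e5 (by positivity)
    nlinarith [(abs_le.1 e6).2]
  · refine DifferentiableOn.div (by fun_prop) (by fun_prop) ?_
    intro u hu
    exact norm_pos_iff.1 (hne u hu).1
  · intro u hu
    simp only [mem_closedBall, dist_zero_right]
    rw [norm_div, div_le_one (hne u hu).1]
    have id1 := aux_id (h 0) (h u)
    have : 0 ≤ (1 - ‖h u‖ ^ 2) * (1 - ‖h 0‖ ^ 2) := by
      have := hb u hu
      apply mul_nonneg <;> nlinarith [norm_nonneg (h u), norm_nonneg (h 0)]
    exact abs_le_of_sq_le_sq' (by linarith) (hne u hu).1.le |>.2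

lemma aux_v (v : ℂ → ℂ) (hd : DifferentiableOn ℂ v (ball 0 1))
    (hb : ∀ z ∈ ball (0:ℂ) 1, ‖v z‖ ≤ 1) (h0 : v 0 = 0) (c : ℝ) (hc : ‖deriv v 0‖ ≤ c)
    (x : ℝ) (hx0 : 0 < x) (hx1 : x < 1) :
    (v x).re ≤ x * (x + c) / (1 + c * x) := by
  have hc0 : 0 ≤ c := (norm_nonneg _).trans hc
  have hxm : (x : ℂ) ∈ ball (0:ℂ) 1 := by simp [abs_of_pos hx0, hx1]
  have hS : ∀ z ∈ ball (0:ℂ) 1, ‖dslope v 0 z‖ ≤ 1 := by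
    intro z hz
    have := Complex.norm_dslope_le_div_of_mapsTo_ball (R₂ := 1) hd
      (by intro u hu; simpa [h0] using hb u hu) hz
    simpa using this
  have := aux_sp (dslope v 0) ((Complex.differentiableOn_dslope (ball_mem_nhds _ one_pos)).2 hd)
    hS x hxm
  have hne : (x : ℂ) ≠ 0 := by exact_mod_cast hx0.ne'
  have hT := hS x hxm
  rw [dslope_same] at this
  have hv : v x = x * dslope v 0 x := by
    rw [dslope_of_ne _ hne, slope_def_field, h0]; field_simp; simp [mul_comm]
  have hxn : ‖(x:ℂ)‖ = x := by simp [abs_of_pos hx0]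
  rw [hxn] at this
  set t := ‖dslope v 0 (x:ℂ)‖
  set a := ‖deriv v 0‖
  have ha : 0 ≤ a := norm_nonneg _
  have ht : t * (1 + c * x) ≤ x + c := by
    have h1 : t * x ≤ 1 := by nlinarith
    nlinarith
  have : (v x).re ≤ x * t := by
    refine (Complex.re_le_norm _).trans ?_
    rw [hv, norm_mul, hxn]
  rw [le_div_iff₀ (by positivity)]
  calc (v x).re * (1 + c * x) ≤ x * t * (1 + c * x) := by gcongr
    _ = x * (t * (1 + c * x)) := by ring
    _ ≤ _ := by gcongr

lemma aux_jack_s5 (v : ℂ → ℂ) (hd : DifferentiableOn ℂ v (ball 0 1)) (hd1 : DifferentiableAt ℂ v 1)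
    (hb : ∀ z ∈ closedBall (0:ℂ) 1, ‖v z‖ ≤ 1) (h0 : v 0 = 0) (h1 : v 1 = 1)
    (c : ℝ) (hc : ‖deriv v 0‖ ≤ c) :
    (deriv v 1).im = 0 ∧ 2 / (1 + c) ≤ (deriv v 1).re := by
  have hc0 : 0 ≤ c := (norm_nonneg _).trans hc
  constructor
  · have e1 : HasDerivAt (fun θ : ℝ => Complex.exp (θ * Complex.I)) Complex.I 0 := by
      have : HasDerivAt (fun θ : ℂ => Complex.exp (θ * Complex.I)) Complex.I ((0:ℝ):ℂ) := by
        simpa using ((hasDerivAt_id (((0:ℝ):ℂ))).mul_const Complex.I).cexp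
      exact this.comp_ofReal
    have e2 : HasDerivAt (fun θ : ℝ => v (Complex.exp (θ * Complex.I))) (deriv v 1 * Complex.I) 0 := by
      have : HasDerivAt v (deriv v 1) (Complex.exp (((0:ℝ):ℂ) * Complex.I)) := by
        simpa using hd1.hasDerivAt
      exact this.comp (0:ℝ) e1
    have e3 : HasDerivAt (fun θ : ℝ => (v (Complex.exp (θ * Complex.I))).re)
        (deriv v 1 * Complex.I).re 0 :=
      (Complex.reCLM.hasFDerivAt.comp_hasDerivAt (0:ℝ) e2)
    have e4 : IsLocalMax (fun θ : ℝ => (v (Complex.exp (θ * Complex.I))).re) 0 := by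
      refine Eventually.of_forall fun θ => ?_
      have := hb (Complex.exp (θ * Complex.I)) (by simp [Complex.norm_exp_ofReal_mul_I])
      simpa [h1] using (Complex.re_le_norm _).trans this
    have := e4.hasDerivAt_eq_zero e3
    simpa using this
  · have e2 : HasDerivAt (fun x : ℝ => v x) (deriv v 1) 1 := by
      have : HasDerivAt v (deriv v 1) ((1:ℝ):ℂ) := by simpa using hd1.hasDerivAt
      exact this.comp_ofReal
    have e3 : HasDerivAt (fun x : ℝ => (v x).re) (deriv v 1).re 1 :=
      (Complex.reCLM.hasFDerivAt.comp_hasDerivAt (1:ℝ) e2)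
    have e4 : HasDerivAt (fun x : ℝ => x * (x + c) / (1 + c * x)) (2 / (1 + c)) 1 := by
      have n : HasDerivAt (fun x : ℝ => x * (x + c)) (1 * (1 + c) + 1 * 1) 1 :=
        (hasDerivAt_id (1:ℝ)).mul ((hasDerivAt_id (1:ℝ)).add_const c)
      have d : HasDerivAt (fun x : ℝ => 1 + c * x) (c * 1) 1 :=
        ((hasDerivAt_id (1:ℝ)).const_mul c).const_add 1
      have hne : (1 + c * 1) ≠ 0 := by positivity
      refine (n.div d hne).congr_deriv ?_
      have : 1 + c ≠ 0 := by positivity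
      simp only [mul_one]
      field_simp
      ring
    have e5 := ((e3.sub e4).hasDerivWithinAt (s := Set.Iio 1))
    rw [hasDerivWithinAt_iff_tendsto_slope' (by simp)] at e5
    have : 0 ≤ (deriv v 1).re - 2 / (1 + c) := by
      refine ge_of_tendsto e5 ?_
      filter_upwards [Ioo_mem_nhdsLT (show (0:ℝ) < 1 by norm_num)] with x hx
      have := aux_v v hd (fun z hz => hb z (ball_subset_closedBall hz)) h0 c hc x hx.1 hx.2
      have hne : (1 + c) ≠ 0 := by positivity
      rw [slope_def_field]
      apply div_nonneg_of_nonpos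
      · simp [h1, hne]
        linarith
      · linarith [hx.2]
    linarith

lemma aux_w (w : ℂ → ℂ) (hd : DifferentiableOn ℂ w (ball 0 1)) (h0 : w 0 = 0)
    (c : ℝ) (hc : ‖deriv w 0‖ ≤ c)
    (H : ∀ z ∈ ball (0:ℂ) 1, z ≠ 0 → ‖w z‖ = 1 → ∀ k : ℝ, 2 / (1 + c) ≤ k →
      z * deriv w z = k * w z → False) : ∀ z ∈ ball (0:ℂ) 1, ‖w z‖ < 1 := by
  by_contra! hcon
  obtain ⟨z1, hz1, hw1⟩ := hcon
  have hz1' : ‖z1‖ < 1 := by simpa using hz1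
  have hsub : closedBall (0:ℂ) ‖z1‖ ⊆ ball 0 1 := closedBall_subset_ball hz1'
  have hcl : IsCompact (closedBall (0:ℂ) ‖z1‖ ∩ (fun z => ‖w z‖) ⁻¹' Set.Ici 1) := by
    refine (isCompact_closedBall _ _).of_isClosed_subset ?_ Set.inter_subset_left
    exact ((hd.continuousOn.mono hsub).norm).preimage_isClosed_of_isClosed isClosed_closedBall
      isClosed_Ici
  obtain ⟨z0, ⟨hz0a, hz0b⟩, hmin⟩ := hcl.exists_isMinOn ⟨z1, by simp, hw1⟩
    (continuous_norm.continuousOn)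
  have hz0a' : ‖z0‖ ≤ ‖z1‖ := by simpa using hz0a
  have hz0b : 1 ≤ ‖w z0‖ := hz0b
  have hlt : ∀ z, ‖z‖ < ‖z0‖ → ‖w z‖ < 1 := by
    intro z hz
    by_contra! h
    have : ‖z0‖ ≤ ‖z‖ := hmin ⟨by simpa using hz.le.trans hz0a', h⟩
    linarith
  have hz0 : z0 ∈ ball (0:ℂ) 1 := hsub hz0a
  have hz0n : ‖z0‖ < 1 := by simpa using hz0
  have hne : z0 ≠ 0 := by
    rintro rfl
    rw [h0] at hz0b; norm_num at hz0b
  have hpos : 0 < ‖z0‖ := norm_pos_iff.2 hne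
  have hle : ∀ z, ‖z‖ ≤ ‖z0‖ → ‖w z‖ ≤ 1 := by
    intro z hz
    have hzm : z ∈ ball (0:ℂ) 1 := by simpa using hz.trans_lt hz0n
    have hcz : ContinuousAt w z := (hd.differentiableAt (isOpen_ball.mem_nhds hzm)).continuousAt
    have t1 : Tendsto (fun t : ℝ => (t : ℂ) * z) (𝓝[<] 1) (𝓝 z) := by
      have : Continuous (fun t : ℝ => (t : ℂ) * z) := by fun_prop
      have := this.tendsto 1
      simp only [Complex.ofReal_one, one_mul] at this
      exact this.mono_left nhdsWithin_le_nhds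
    refine le_of_tendsto ((hcz.tendsto.comp t1).norm) ?_
    filter_upwards [Ioo_mem_nhdsLT (show (0:ℝ) < 1 by norm_num)] with t ht
    refine (hlt _ ?_).le
    rw [norm_mul, Complex.norm_real, Real.norm_of_nonneg ht.1.le]
    nlinarith [ht.1, ht.2, norm_nonneg z]
  have hw0 : ‖w z0‖ = 1 := le_antisymm (hle z0 le_rfl) hz0b
  have hw0ne : w z0 ≠ 0 := by rw [← norm_pos_iff, hw0]; norm_num
  have hder : ∀ ζ : ℂ, ‖ζ‖ ≤ 1 → HasDerivAt (fun ζ => w (z0 * ζ) / w z0)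
      (deriv w (z0 * ζ) * z0 / w z0) ζ := by
    intro ζ hζ
    have hm : z0 * ζ ∈ ball (0:ℂ) 1 := by
      simp only [mem_ball, dist_zero_right, norm_mul]; nlinarith
    have h1 : HasDerivAt (fun ζ => z0 * ζ) z0 ζ := by
      simpa using (hasDerivAt_id ζ).const_mul z0
    exact (((hd.differentiableAt (isOpen_ball.mem_nhds hm)).hasDerivAt).comp ζ h1).div_const _
  have J := aux_jack_s5 (fun ζ => w (z0 * ζ) / w z0)
    (fun ζ hζ => (hder ζ (by simpa using (mem_ball.1 hζ).le)).differentiableAt.differentiableWithinAt)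
    (hder 1 (by simp)).differentiableAt ?_ (by simp [h0]) (by simp [hw0ne]) c ?_
  · rw [(hder 1 (by simp)).deriv] at J
    simp only [mul_one] at J
    refine H z0 hz0 hne hw0 (deriv w z0 * z0 / w z0).re J.2 ?_
    have : (((deriv w z0 * z0 / w z0).re : ℝ) : ℂ) = deriv w z0 * z0 / w z0 := by
      apply Complex.ext <;> simp [J.1]
    rw [this]; field_simp
  · intro ζ hζ
    have : ‖ζ‖ ≤ 1 := by simpa using hζ
    rw [norm_div, hw0, div_one]
    apply hle
    rw [norm_mul]; nlinarith
  · rw [(hder 0 (by simp)).deriv]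
    simp only [mul_zero, norm_div, norm_mul, hw0, div_one]
    nlinarith [norm_nonneg (deriv w 0)]

lemma aux_re (p k : ℝ) (w Z : ℂ) (hw : ‖w‖ = 1) (hw1 : w ≠ 1) (h : (1 - w) * Z = p + k * w) :
    Z.re = (p - k) / 2 := by
  have hn : w.re ^ 2 + w.im ^ 2 = 1 := by
    have := Complex.sq_norm w
    rw [hw, Complex.normSq_apply] at this; nlinarith
  have hr := congrArg Complex.re h
  have hi := congrArg Complex.im h
  simp at hr hi
  have hre : w.re ≠ 1 := by
    intro h1
    apply hw1
    have : w.im = 0 := by rw [h1] at hn; nlinarith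
    apply Complex.ext <;> simp [h1, this]
  have : (1 - w.re) * (Z.re - (p - k) / 2) = 0 := by
    linear_combination (1 - w.re) / 2 * hr - w.im / 2 * hi + (- k / 2 - Z.re/2) * hn
  rcases mul_eq_zero.1 this with h | h
  · exact absurd (by linarith) hre
  · linarith

lemma aux_fin (p : ℝ) (hp : 0 < p) (w Z : ℂ) (hw : ‖w‖ < 1) (h : (1 - w) * Z = p) :
    p / 2 < Z.re := by
  have hn : w.re ^ 2 + w.im ^ 2 < 1 := by
    have := Complex.sq_norm w
    rw [Complex.normSq_apply] at this; nlinarith [norm_nonneg w]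
  have hr := congrArg Complex.re h
  have hi := congrArg Complex.im h
  simp at hr hi
  set a := w.re
  set d := w.im
  have hD : 0 < (1 - a) ^ 2 + d ^ 2 := by nlinarith
  have e : ((1 - a) ^ 2 + d ^ 2) * (Z.re - p / 2) = p / 2 * (1 - (a ^ 2 + d ^ 2)) := by
    linear_combination (1 - a) * hr - d * hi
  have : 0 < ((1 - a) ^ 2 + d ^ 2) * (Z.re - p / 2) := by rw [e]; apply mul_pos <;> linarith
  have := pos_of_mul_pos_right this hD.le
  linarith

theorem stmt_5 (p : ℕ) (hp : 1 ≤ p) (b : ℝ) (hb0 : 0 ≤ b) (hb1 : b ≤ (p : ℝ))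
    (f g : ℂ → ℂ) (hg : DifferentiableOn ℂ g (Metric.ball 0 1)) (hg0 : g 0 = 1)
    (hgb : deriv g 0 = (b : ℂ))
    (hfg : ∀ z ∈ Metric.ball (0 : ℂ) 1, f z = z ^ p * g z)
    (hf' : ∀ z ∈ Metric.ball (0 : ℂ) 1, z ≠ 0 → deriv f z ≠ 0)
    (hfne : ∀ z ∈ Metric.ball (0 : ℂ) 1, z ≠ 0 → f z ≠ 0)
    (hconv : ∀ z ∈ Metric.ball (0 : ℂ) 1, z ≠ 0 →
      ((p : ℝ) / 2) * (1 - 2 / ((p : ℝ) + b)) < (1 + z * deriv (deriv f) z / deriv f z).re) :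
    ∀ z ∈ Metric.ball (0 : ℂ) 1, z ≠ 0 → (p : ℝ) / 2 < (z * deriv f z / f z).re := by
  have hpR : (0:ℝ) < p := by exact_mod_cast hp
  have hpC : (p:ℂ) ≠ 0 := by exact_mod_cast hpR.ne'
  have nh : ∀ z ∈ ball (0:ℂ) 1, ball (0:ℂ) 1 ∈ 𝓝 z := fun z hz => isOpen_ball.mem_nhds hz
  have hg' : DifferentiableOn ℂ (deriv g) (ball 0 1) := hg.deriv isOpen_ball
  have hgne : ∀ z ∈ ball (0:ℂ) 1, g z ≠ 0 := by
    intro z hz h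
    by_cases hz0 : z = 0
    · rw [hz0, hg0] at h; exact one_ne_zero h
    · exact hfne z hz hz0 (by rw [hfg z hz, h, mul_zero])
  obtain ⟨N, hN⟩ : ∃ N : ℂ → ℂ, N = fun z => p * g z + z * deriv g z := ⟨_, rfl⟩
  have hNd : DifferentiableOn ℂ N (ball 0 1) := by rw [hN]; fun_prop
  have hpow : ∀ z : ℂ, z ^ p = z * z ^ (p - 1) := by
    intro z; rw [← pow_succ']; congr 1; omega
  have hfd : ∀ z ∈ ball (0:ℂ) 1, z * deriv f z = z ^ p * N z := by
    intro z hz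
    have e1 : HasDerivAt (fun z => z ^ p * g z) (p * z ^ (p-1) * g z + z ^ p * deriv g z) z :=
      (hasDerivAt_pow p z).mul (hg.differentiableAt (nh z hz)).hasDerivAt
    have e2 : f =ᶠ[𝓝 z] fun z => z ^ p * g z := by
      filter_upwards [nh z hz] with u hu using hfg u hu
    rw [e2.deriv_eq, e1.deriv, hN]
    simp only [hpow z]; ring
  have hfdiff : DifferentiableOn ℂ f (ball 0 1) := by
    refine DifferentiableOn.congr (f := fun z => z ^ p * g z) (by fun_prop) hfg
  have hf'd : DifferentiableOn ℂ (deriv f) (ball 0 1) := hfdiff.deriv isOpen_ball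
  have hNne : ∀ z ∈ ball (0:ℂ) 1, N z ≠ 0 := by
    intro z hz h
    by_cases hz0 : z = 0
    · rw [hz0, hN] at h; simp [hg0] at h; omega
    · have := hfd z hz
      rw [h, mul_zero] at this
      exact (mul_ne_zero hz0 (hf' z hz hz0)) this
  have hfd2 : ∀ z ∈ ball (0:ℂ) 1, z ≠ 0 →
      1 + z * deriv (deriv f) z / deriv f z = p + z * deriv N z / N z := by
    intro z hz hz0
    have e1 : HasDerivAt (fun z => z ^ p * N z) (p * z ^ (p-1) * N z + z ^ p * deriv N z) z :=
      (hasDerivAt_pow p z).mul (hNd.differentiableAt (nh z hz)).hasDerivAt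
    have e2 : HasDerivAt (fun z => z * deriv f z) (1 * deriv f z + z * deriv (deriv f) z) z :=
      (hasDerivAt_id z).mul (hf'd.differentiableAt (nh z hz)).hasDerivAt
    have e3 : (fun z => z * deriv f z) =ᶠ[𝓝 z] fun z => z ^ p * N z := by
      filter_upwards [nh z hz] with u hu using hfd u hu
    have e4 := (e1.congr_of_eventuallyEq e3).unique e2
    have e5 : deriv f z = z ^ (p-1) * N z := by
      apply mul_left_cancel₀ hz0
      rw [hfd z hz, hpow z]; ring
    have e6 := hf' z hz hz0
    have e7 := hNne z hz
    rw [hpow z] at e4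
    have : (1 + z * deriv (deriv f) z / deriv f z) * deriv f z
        = (p + z * deriv N z / N z) * deriv f z := by
      rw [add_mul, div_mul_cancel₀ _ e6, ← e4, e5]
      field_simp
    exact mul_right_cancel₀ e6 this
  obtain ⟨w, hw⟩ : ∃ w : ℂ → ℂ, w = fun z => z * deriv g z / N z := ⟨_, rfl⟩
  have hwd : DifferentiableOn ℂ w (ball 0 1) := by
    rw [hw]; exact DifferentiableOn.div (by fun_prop) hNd hNne
  have hwN : ∀ z ∈ ball (0:ℂ) 1, (1 - w z) * N z = p * g z := by
    intro z hz
    have := hNne z hz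
    have e : w z * N z = z * deriv g z := by rw [hw]; field_simp
    rw [sub_mul, e, hN]; ring
  have hwN' : ∀ z ∈ ball (0:ℂ) 1,
      - deriv w z * N z + (1 - w z) * deriv N z = p * deriv g z := by
    intro z hz
    have e1 := ((hwd.differentiableAt (nh z hz)).hasDerivAt.const_sub 1).mul
      (hNd.differentiableAt (nh z hz)).hasDerivAt
    have e2 := (hg.differentiableAt (nh z hz)).hasDerivAt.const_mul (p:ℂ)
    refine (e1.congr_of_eventuallyEq ?_).unique e2
    filter_upwards [nh z hz] with u hu using (hwN u hu).symm
  have hw0 : w 0 = 0 := by rw [hw]; simp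
  have hwne : ∀ z ∈ ball (0:ℂ) 1, w z ≠ 1 := by
    intro z hz h
    have := hwN z hz
    rw [h, sub_self, zero_mul] at this
    exact mul_ne_zero hpC (hgne z hz) this.symm
  have hN0 : N 0 = p := by rw [hN]; simp [hg0]
  have hwd0 : deriv w 0 = ((b / p : ℝ) : ℂ) := by
    have h0 : (0:ℂ) ∈ ball (0:ℂ) 1 := by simp
    have e1 : HasDerivAt (fun z => z * deriv g z) (1 * deriv g 0 + 0 * deriv (deriv g) 0) 0 :=
      (hasDerivAt_id (0:ℂ)).mul (hg'.differentiableAt (nh 0 h0)).hasDerivAt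
    have e2 := e1.div (hNd.differentiableAt (nh 0 h0)).hasDerivAt (hNne 0 h0)
    have e3 := e2
    rw [show (fun z => z * deriv g z) / N = w by rw [hw]; rfl] at e3
    rw [e3.deriv, hN0, hgb]
    push_cast
    field_simp
    ring
  have hlt := aux_w w hwd hw0 (b / p) (by
    rw [hwd0, Complex.norm_real, Real.norm_of_nonneg (by positivity)]) (by
    intro z hz hz0 hwz k hk hkz
    have hc := hconv z hz hz0
    rw [hfd2 z hz hz0] at hc
    have hNz := hNne z hz
    have := aux_re p k (w z) (p + z * deriv N z / N z) hwz (hwne z hz) (by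
      have e1 := hwN' z hz
      have e2 : w z * N z = z * deriv g z := by rw [hw]; field_simp
      apply mul_right_cancel₀ hNz
      have e3 : (p + z * deriv N z / N z) * N z = p * N z + z * deriv N z := by field_simp
      rw [mul_assoc, e3]
      push_cast
      linear_combination z * e1 + N z * hkz - p * e2)
    rw [this] at hc
    have e : 2 / (1 + b / p) = 2 * p / (p + b) := by
      have : (p:ℝ) + b ≠ 0 := by positivity
      field_simp
    rw [e] at hk
    have e' : (p:ℝ) / 2 * (1 - 2 / (p + b)) = p / 2 - (2 * p / (p + b)) / 2 := by ring
    rw [e'] at hc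
    linarith)
  intro z hz hz0
  refine aux_fin p hpR (w z) _ (hlt z hz) ?_
  have hgz := hgne z hz
  have hzp : z ^ p ≠ 0 := pow_ne_zero _ hz0
  rw [hfd z hz, hfg z hz, mul_div_mul_left _ _ hzp, ← mul_div_assoc, hwN z hz]
  field_simp
  simp
end

section
/- Let p ∈ ℕ (p ≥ 1), 0 < γ < 1 and 0 ≤ b ≤ 2(1−γ). Set β = p − 2γ/(2(1−γ)+b) if 0 < γ ≤ 1/2, and β = p − 2(1−γ)²/(γ(2(1−γ)+b)) if 1/2 ≤ γ < 1. If f ∈ 𝒜_{p,b} satisfies f(z) ≠ 0 for all z ∈ 𝔻 \ {0} and Re(z f'(z)/f(z)) > β for all z ∈ 𝔻 \ {0}, then Re(f(z)/z^p) > γ for all z ∈ 𝔻 \ {0} (equivalently, the analytic extension g of f(z)/z^p satisfies Re g(z) > γ on 𝔻). -/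
open Metric Set Filter Topology in
lemma aux_schwarz_s6 (W : ℂ → ℂ) (hW : DifferentiableOn ℂ W (ball 0 1))
    (hm : MapsTo W (ball 0 1) (closedBall 0 1)) (h0 : W 0 = 0) (c : ℝ)
    (hc : ‖deriv W 0‖ = c) (hc1 : c < 1) (ζ : ℂ) (hζ : ‖ζ‖ < 1) :
    ‖W ζ‖ * (1 + c * ‖ζ‖) ≤ ‖ζ‖ * (c + ‖ζ‖) := by
  have hc0 : 0 ≤ c := hc ▸ norm_nonneg _
  set V := dslope W 0 with hV
  have hVd : DifferentiableOn ℂ V (ball 0 1) :=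
    (Complex.differentiableOn_dslope (ball_mem_nhds _ one_pos)).2 hW
  have hVle : ∀ z ∈ ball (0:ℂ) 1, ‖V z‖ ≤ 1 := by
    intro z hz
    have := Complex.norm_dslope_le_div_of_mapsTo_ball (R₂ := 1) hW (by rw [h0]; exact hm) hz
    simpa using this
  set v0 := deriv W 0 with hv0
  have hV0 : V 0 = v0 := by simp [hV, hv0]
  have hden : ∀ z ∈ ball (0:ℂ) 1, 1 - (starRingEnd ℂ) v0 * V z ≠ 0 := by
    intro z hz h
    have h1 : (starRingEnd ℂ) v0 * V z = 1 := (sub_eq_zero.1 h).symm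
    have h2 : ‖v0‖ * ‖V z‖ = 1 := by
      have := congrArg norm h1
      simpa using this
    have := hVle z hz
    rw [hc] at h2
    nlinarith [norm_nonneg (V z)]
  have key : ∀ v : ℂ, Complex.normSq (1 - (starRingEnd ℂ) v0 * v) - Complex.normSq (v - v0)
      = (1 - Complex.normSq v) * (1 - Complex.normSq v0) := by
    intro v
    simp [Complex.normSq_apply]
    ring
  have hn0 : Complex.normSq v0 = c ^ 2 := by rw [Complex.normSq_eq_norm_sq, hc]
  have hsch := Complex.norm_le_norm_of_mapsTo_ball (R := 1) (z := ζ)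
    (f := fun z => (V z - v0) / (1 - (starRingEnd ℂ) v0 * V z))
    ((hVd.sub_const _).div ((hVd.const_mul _).const_sub _) hden) ?_ (by simp [hV0]) hζ
  · have hζm : ζ ∈ ball (0:ℂ) 1 := by simpa using hζ
    have hdp : 0 < ‖1 - (starRingEnd ℂ) v0 * V ζ‖ := norm_pos_iff.2 (hden ζ hζm)
    rw [norm_div, div_le_iff₀ hdp] at hsch
    have hk := key (V ζ)
    simp only [Complex.normSq_eq_norm_sq, hc] at hk
    have hsq : ‖V ζ - v0‖ ^ 2 ≤ ‖ζ‖ ^ 2 * ‖1 - (starRingEnd ℂ) v0 * V ζ‖ ^ 2 := by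
      rw [← mul_pow]; exact pow_le_pow_left₀ (norm_nonneg _) hsch 2
    have htri : ‖V ζ - v0‖ ≥ |‖V ζ‖ - c| := by
      rw [← hc]; exact abs_norm_sub_norm_le _ _
    have htri2 : (‖V ζ‖ - c) ^ 2 ≤ ‖V ζ - v0‖ ^ 2 := by
      rw [← sq_abs]; exact pow_le_pow_left₀ (abs_nonneg _) htri 2
    have hV1 := hVle ζ hζm
    have ht0 := norm_nonneg ζ
    have hVn := norm_nonneg (V ζ)
    have hWV : ‖W ζ‖ = ‖ζ‖ * ‖V ζ‖ := by
      have := sub_smul_dslope W 0 ζ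
      rw [← norm_mul, hV]
      simp [h0] at this
      rw [this]
    have h3 : (‖V ζ‖ - c) ^ 2 ≤ (‖ζ‖ * (1 - c * ‖V ζ‖)) ^ 2 := by
      generalize ‖1 - (starRingEnd ℂ) v0 * V ζ‖ = A at *
      generalize ‖V ζ - v0‖ = B at *
      generalize ‖V ζ‖ = x at *
      generalize ‖ζ‖ = t at *
      have hA : A ^ 2 = B ^ 2 + (1 - x ^ 2) * (1 - c ^ 2) := by linarith
      rw [hA] at hsq
      have ht2 : 0 ≤ 1 - t ^ 2 := by nlinarith
      have := mul_le_mul_of_nonneg_left htri2 ht2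
      nlinarith
    have h4 := abs_le_of_sq_le_sq h3 (mul_nonneg ht0 (by nlinarith))
    have h5 := (abs_le.1 h4).2
    rw [hWV]
    nlinarith
  · intro z hz
    have hdp : 0 < ‖1 - (starRingEnd ℂ) v0 * V z‖ := norm_pos_iff.2 (hden z hz)
    have hk := key (V z)
    simp only [Complex.normSq_eq_norm_sq, hc] at hk
    have hV1 := hVle z hz
    simp only [mem_closedBall, dist_zero_right, norm_div]
    rw [div_le_one hdp]
    apply le_of_sq_le_sq _ hdp.le
    have : 0 ≤ (1 - ‖V z‖^2) * (1 - c^2) :=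
      mul_nonneg (by nlinarith [norm_nonneg (V z)]) (by nlinarith)
    linarith

open Metric Set Filter Topology in
lemma aux_pick (G : ℂ → ℂ) (hG : DifferentiableOn ℂ G (ball 0 1)) (γ : ℝ) (hγ : γ < 1)
    (hre : ∀ z ∈ ball (0:ℂ) 1, γ < (G z).re) (h0 : G 0 = 1) (c : ℝ)
    (hc : ‖deriv G 0‖ = 2 * (1 - γ) * c) (hc1 : c < 1) (ζ : ℂ) (hζ : ‖ζ‖ < 1) :
    ‖G ζ - 1‖ * (1 + c * ‖ζ‖) ≤ ‖ζ‖ * (c + ‖ζ‖) * ‖G ζ + (1 - 2 * γ : ℝ)‖ := by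
  have hden : ∀ z ∈ ball (0:ℂ) 1, G z + (1 - 2 * γ : ℝ) ≠ 0 := by
    intro z hz h
    have h1 := congrArg Complex.re h
    have := hre z hz
    simp only [Complex.add_re, Complex.ofReal_re, Complex.zero_re] at h1
    linarith
  have h00 : (0:ℂ) ∈ ball (0:ℂ) 1 := by simp
  have hGd : HasDerivAt G (deriv G 0) 0 :=
    ((hG 0 h00).differentiableAt (ball_mem_nhds _ one_pos)).hasDerivAt
  have hWd := (hGd.sub_const 1).div (hGd.add_const ((1 - 2 * γ : ℝ) : ℂ)) (hden 0 h00)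
  have hγp : 0 < 1 - γ := by linarith
  have h := aux_schwarz_s6 (fun z => (G z - 1) / (G z + (1 - 2 * γ : ℝ)))
    ((hG.sub_const _).div (hG.add_const _) hden) ?_ (by simp [h0]) c ?_ hc1 ζ hζ
  · have hζm : ζ ∈ ball (0:ℂ) 1 := by simpa using hζ
    have hdp := norm_pos_iff.2 (hden ζ hζm)
    rw [norm_div, div_mul_eq_mul_div, div_le_iff₀ hdp] at h
    exact h
  · intro z hz
    have hdp := norm_pos_iff.2 (hden z hz)
    simp only [mem_closedBall, dist_zero_right, norm_div]
    rw [div_le_one hdp]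
    apply le_of_sq_le_sq _ hdp.le
    rw [← Complex.normSq_eq_norm_sq, ← Complex.normSq_eq_norm_sq]
    have := hre z hz
    simp [Complex.normSq_apply]
    nlinarith
  · have h2 : (2 * (1 - γ) : ℝ) ≠ 0 := by positivity
    have e : ((1:ℂ) + (1 - 2 * γ : ℝ)) = ((2 * (1 - γ) : ℝ) : ℂ) := by push_cast; ring
    have hd : deriv (fun z => (G z - 1) / (G z + (1 - 2 * γ : ℝ))) 0
      = deriv G 0 / ((2 * (1 - γ) : ℝ) : ℂ) := by
      refine hWd.deriv.trans ?_
      rw [h0, e]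
      have : ((2 * (1 - γ) : ℝ) : ℂ) ≠ 0 := Complex.ofReal_ne_zero.2 h2
      field_simp
      ring
    rw [hd, norm_div, hc, Complex.norm_real, Real.norm_of_nonneg (by positivity)]
    field_simp

open Metric Set Filter Topology in
lemma aux_left_s6 (h : ℝ → ℝ) (h' : ℝ) (hd : HasDerivAt h h' 1) (h1 : h 1 = 0)
    (hp : ∀ t, 0 < t → t < 1 → 0 ≤ h t) : h' ≤ 0 := by
  have := (hasDerivWithinAt_iff_tendsto_slope' (s := Iio 1) (by simp)).1 (hd.hasDerivWithinAt)
  refine le_of_tendsto this ?_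
  have : Ioo (0:ℝ) 1 ∈ 𝓝[<] (1:ℝ) := Ioo_mem_nhdsLT one_pos
  filter_upwards [this] with t ht
  rw [slope_def_field, h1]
  exact div_nonpos_of_nonneg_of_nonpos (by linarith [hp t ht.1 ht.2]) (by linarith [ht.2])

open Metric Set Filter Topology in
lemma aux_deriv (g : ℂ → ℂ) (hg : DifferentiableOn ℂ g (ball 0 1)) (γ b : ℝ) (hγ1 : γ < 1)
    (hb0 : 0 ≤ b) (hb1 : b ≤ 2 * (1 - γ)) (hg0 : g 0 = 1) (hgb : deriv g 0 = (b : ℂ))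
    (z₀ : ℂ) (hz₀ : z₀ ∈ ball (0:ℂ) 1) (hz0 : z₀ ≠ 0) (hre₀ : (g z₀).re = γ)
    (hlt : ∀ z : ℂ, ‖z‖ < ‖z₀‖ → γ < (g z).re)
    (hle : ∀ z : ℂ, ‖z‖ ≤ ‖z₀‖ → γ ≤ (g z).re) :
    (z₀ * deriv g z₀).im = 0 ∧
    (z₀ * deriv g z₀).re * (2 * (1 - γ) + b) ≤ - (2 * ((1 - γ) ^ 2 + (g z₀).im ^ 2)) := by
  have hγp : 0 < 1 - γ := by linarith
  have hr1 : ‖z₀‖ < 1 := by simpa using hz₀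
  have hr0 : 0 < ‖z₀‖ := norm_pos_iff.2 hz0
  have hgd : HasDerivAt g (deriv g z₀) z₀ :=
    ((hg z₀ hz₀).differentiableAt (isOpen_ball.mem_nhds hz₀)).hasDerivAt
  constructor
  · have hexp : HasDerivAt (fun θ : ℝ => Complex.exp (θ * Complex.I) * z₀)
        (Complex.I * z₀) 0 := by
      have h1 : HasDerivAt (fun θ : ℂ => Complex.exp (θ * Complex.I) * z₀)
        (Complex.I * z₀) ((0:ℝ):ℂ) := by
        have := (((hasDerivAt_id ((0:ℝ):ℂ)).mul_const Complex.I).cexp).mul_const z₀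
        simpa using this
      exact h1.comp_ofReal
    have hgd' : HasDerivAt g (deriv g z₀)
        ((fun θ : ℝ => Complex.exp (θ * Complex.I) * z₀) 0) := by simpa using hgd
    have hc := HasDerivAt.comp (0:ℝ) hgd' hexp
    have hr := Complex.reCLM.hasFDerivAt.comp_hasDerivAt (0:ℝ) hc
    have hmin : IsLocalMin (fun θ : ℝ => (g (Complex.exp (θ * Complex.I) * z₀)).re) 0 := by
      refine Eventually.of_forall fun θ => ?_
      have : ‖Complex.exp (θ * Complex.I) * z₀‖ ≤ ‖z₀‖ := by
        rw [norm_mul, Complex.norm_exp_ofReal_mul_I, one_mul]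
      simpa [hre₀] using hle _ this
    have h0 := hmin.hasDerivAt_eq_zero hr
    have e : deriv g z₀ * (Complex.I * z₀) = Complex.I * (z₀ * deriv g z₀) := by ring
    rw [e] at h0
    simp only [Complex.reCLM_apply, Complex.I_mul_re] at h0
    linarith
  · set c : ℝ := ‖z₀‖ * b / (2 * (1 - γ)) with hcdef
    have hc0 : 0 ≤ c := by positivity
    have hcm : c * (2 * (1 - γ)) = ‖z₀‖ * b := by rw [hcdef]; field_simp
    have hcb : c * (2 * (1 - γ)) ≤ b := by rw [hcm]; nlinarith
    have hc1 : c < 1 := by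
      rw [hcdef, div_lt_one (by positivity)]
      rcases eq_or_lt_of_le hb0 with h | h
      · rw [← h]; simp; linarith
      · nlinarith
    have hmap : ∀ ζ ∈ ball (0:ℂ) 1, ‖ζ * z₀‖ < ‖z₀‖ := by
      intro ζ hζ
      have : ‖ζ‖ < 1 := by simpa using hζ
      rw [norm_mul]; nlinarith
    have hGd : DifferentiableOn ℂ (fun ζ => g (ζ * z₀)) (ball 0 1) := by
      refine DifferentiableOn.comp (t := ball 0 1) hg (by fun_prop) ?_
      intro ζ hζ
      have := hmap ζ hζ
      simp only [mem_ball, dist_zero_right]; linarith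
    have hd0 : deriv (fun ζ => g (ζ * z₀)) 0 = z₀ * b := by
      have h00 : (0:ℂ) ∈ ball (0:ℂ) 1 := by simp
      have h1 : HasDerivAt g (deriv g 0) ((fun ζ : ℂ => ζ * z₀) 0) := by
        simpa using ((hg 0 h00).differentiableAt (ball_mem_nhds _ one_pos)).hasDerivAt
      have h2 : HasDerivAt (fun ζ : ℂ => ζ * z₀) z₀ 0 := by
        simpa using (hasDerivAt_id (0:ℂ)).mul_const z₀
      have := (HasDerivAt.comp (0:ℂ) h1 h2).deriv
      rw [hgb] at this
      rw [mul_comm]; exact this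
    have hpick := aux_pick (fun ζ => g (ζ * z₀)) hGd γ hγ1 (fun z hz => hlt _ (hmap z hz))
      (by simp [hg0]) c (by rw [hd0, norm_mul, Complex.norm_real, Real.norm_of_nonneg hb0,
        mul_comm (2 * (1 - γ)), hcm]) hc1
    have hlin : HasDerivAt (fun t : ℝ => (t:ℂ) * z₀) z₀ 1 := by
      have h1 : HasDerivAt (fun t : ℂ => t * z₀) z₀ ((1:ℝ):ℂ) := by
        simpa using (hasDerivAt_id ((1:ℝ):ℂ)).mul_const z₀
      exact h1.comp_ofReal
    have hgd' : HasDerivAt g (deriv g z₀) ((fun t : ℝ => (t:ℂ) * z₀) 1) := by simpa using hgd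
    have hc := HasDerivAt.comp (1:ℝ) hgd' hlin
    rw [mul_comm] at hc
    have hR : HasDerivAt (fun t : ℝ => (g ((t:ℂ) * z₀)).re) (z₀ * deriv g z₀).re 1 :=
      Complex.reCLM.hasFDerivAt.comp_hasDerivAt (1:ℝ) hc
    have hI : HasDerivAt (fun t : ℝ => (g ((t:ℂ) * z₀)).im) (z₀ * deriv g z₀).im 1 :=
      Complex.imCLM.hasFDerivAt.comp_hasDerivAt (1:ℝ) hc
    have hid := hasDerivAt_id (1:ℝ)
    have hh := (((hid.pow 2).mul ((hid.const_add c).pow 2)).mul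
        (((hR.add_const (1 - 2 * γ)).pow 2).add (hI.pow 2))).sub
      ((((hid.const_mul c).const_add 1).pow 2).mul
        (((hR.sub_const 1).pow 2).add (hI.pow 2)))
    have hfin := aux_left_s6 _ _ hh ?_ ?_
    · simp [hre₀] at hfin
      set D := (z₀ * deriv g z₀).re with hD
      set y := (g z₀).im with hy
      have hfin' : (1 + c) * (4 * ((1 - γ) ^ 2 + y ^ 2) + (1 + c) * (4 * (1 - γ)) * D) ≤ 0 := by
        simp only [hD, Complex.mul_re]
        nlinarith [hfin]
      have h2 : 4 * ((1 - γ) ^ 2 + y ^ 2) + (1 + c) * (4 * (1 - γ)) * D ≤ 0 := by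
        by_contra hcon
        push Not at hcon
        nlinarith [mul_pos (by linarith : 0 < 1 + c) hcon]
      have hDneg : D ≤ 0 := by
        by_contra hcon
        push Not at hcon
        have : 0 < (1 + c) * (4 * (1 - γ)) * D := by positivity
        nlinarith [sq_nonneg y, sq_nonneg (1 - γ)]
      nlinarith
    · simp [hre₀]
      ring
    · intro t ht0 ht1
      have hn : ‖(t:ℂ)‖ = t := by simp [abs_of_pos ht0]
      have h := hpick (t:ℂ) (by rw [hn]; exact ht1)
      rw [hn] at h
      have h2 := pow_le_pow_left₀ (by positivity) h 2
      rw [mul_pow, mul_pow _ ‖_‖, ← Complex.normSq_eq_norm_sq, ← Complex.normSq_eq_norm_sq] at h2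
      simp only [Complex.normSq_apply, Complex.sub_re, Complex.sub_im, Complex.add_re,
        Complex.add_im, Complex.ofReal_re, Complex.ofReal_im, Complex.one_re, Complex.one_im] at h2
      simp
      nlinarith [h2]


/-- Theorem 3.3: for `f ∈ 𝒜_{p,b}` with `0 < γ < 1` and `0 ≤ b ≤ 2(1-γ)`,
`Re(z f'/f) > β` on the punctured disk implies `Re(f(z)/z^p) > γ` there,
with `β` as specified. -/
theorem stmt_6 (p : ℕ) (hp : 1 ≤ p) (γ b β : ℝ) (hγ0 : 0 < γ) (hγ1 : γ < 1)
    (hb0 : 0 ≤ b) (hb1 : b ≤ 2 * (1 - γ))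
    (hβ : β = if γ ≤ 1 / 2 then (p : ℝ) - 2 * γ / (2 * (1 - γ) + b)
      else (p : ℝ) - 2 * (1 - γ) ^ 2 / (γ * (2 * (1 - γ) + b)))
    (f g : ℂ → ℂ) (hg : DifferentiableOn ℂ g (Metric.ball 0 1)) (hg0 : g 0 = 1)
    (hgb : deriv g 0 = (b : ℂ))
    (hfg : ∀ z ∈ Metric.ball (0 : ℂ) 1, f z = z ^ p * g z)
    (hfne : ∀ z ∈ Metric.ball (0 : ℂ) 1, z ≠ 0 → f z ≠ 0)
    (hstar : ∀ z ∈ Metric.ball (0 : ℂ) 1, z ≠ 0 → β < (z * deriv f z / f z).re) :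
    ∀ z ∈ Metric.ball (0 : ℂ) 1, z ≠ 0 → γ < (f z / z ^ p).re := by
  have hγp : 0 < 1 - γ := by linarith
  by_contra hcon
  push Not at hcon
  obtain ⟨z₁, hz₁, hz₁0, hz₁le⟩ := hcon
  have hdiv : ∀ z ∈ Metric.ball (0:ℂ) 1, z ≠ 0 → f z / z ^ p = g z := by
    intro z hz h
    rw [hfg z hz]; field_simp
  rw [hdiv z₁ hz₁ hz₁0] at hz₁le
  have hr1 : ‖z₁‖ < 1 := by simpa using hz₁
  have hsub : Metric.closedBall (0:ℂ) ‖z₁‖ ⊆ Metric.ball 0 1 := Metric.closedBall_subset_ball hr1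
  have hcomp : IsCompact (Metric.closedBall (0:ℂ) ‖z₁‖ ∩ (fun z => (g z).re) ⁻¹' Set.Iic γ) := by
    refine (isCompact_closedBall (0:ℂ) ‖z₁‖).of_isClosed_subset ?_ Set.inter_subset_left
    refine ContinuousOn.preimage_isClosed_of_isClosed ?_ Metric.isClosed_closedBall isClosed_Iic
    exact Complex.continuous_re.comp_continuousOn (hg.continuousOn.mono hsub)
  obtain ⟨z₀, ⟨hz₀m, hz₀le⟩, hz₀min⟩ := hcomp.exists_isMinOn ⟨z₁, by simp, hz₁le⟩
    (continuous_norm.continuousOn)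
  have hz₀ : z₀ ∈ Metric.ball (0:ℂ) 1 := hsub hz₀m
  have hz₀n : ‖z₀‖ ≤ ‖z₁‖ := by simpa using hz₀m
  have hz₀le' : (g z₀).re ≤ γ := hz₀le
  have hz0 : z₀ ≠ 0 := by
    rintro rfl
    rw [hg0] at hz₀le'
    simp at hz₀le'; linarith
  have hr0 : 0 < ‖z₀‖ := norm_pos_iff.2 hz0
  have hlt : ∀ z : ℂ, ‖z‖ < ‖z₀‖ → γ < (g z).re := by
    intro z hz
    by_contra h
    push Not at h
    have : ‖z₀‖ ≤ ‖z‖ := hz₀min ⟨by simp; linarith, h⟩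
    linarith
  have hle : ∀ z : ℂ, ‖z‖ ≤ ‖z₀‖ → γ ≤ (g z).re := by
    intro z hz
    have hzb : z ∈ Metric.ball (0:ℂ) 1 := hsub (by simp; linarith)
    have hcont : ContinuousAt g z :=
      hg.continuousOn.continuousAt (Metric.isOpen_ball.mem_nhds hzb)
    have hT : Filter.Tendsto (fun t : ℝ => (g ((t:ℂ) * z)).re)
        (nhdsWithin 1 (Set.Iio 1)) (nhds (g z).re) := by
      have h1 : Filter.Tendsto (fun t : ℝ => (t:ℂ) * z) (nhds 1) (nhds z) := by
        have : Continuous (fun t : ℝ => (t:ℂ) * z) := by fun_prop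
        simpa using this.tendsto 1
      exact ((Complex.continuous_re.tendsto _).comp (hcont.tendsto.comp h1)).mono_left
        nhdsWithin_le_nhds
    refine ge_of_tendsto hT ?_
    have : Set.Ioo (0:ℝ) 1 ∈ nhdsWithin (1:ℝ) (Set.Iio 1) := Ioo_mem_nhdsLT one_pos
    filter_upwards [this] with t ht
    refine (hlt _ ?_).le
    rw [norm_mul, Complex.norm_real, Real.norm_of_nonneg ht.1.le]
    nlinarith [ht.1, ht.2, norm_nonneg z]
  have hre₀ : (g z₀).re = γ := le_antisymm hz₀le' (hle z₀ le_rfl)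
  obtain ⟨him, hD⟩ := aux_deriv g hg γ b hγ1 hb0 hb1 hg0 hgb z₀ hz₀ hz0 hre₀ hlt hle
  have hgne : g z₀ ≠ 0 := by
    intro h
    apply hfne z₀ hz₀ hz0
    rw [hfg z₀ hz₀, h, mul_zero]
  have hfd : deriv f z₀ = p * z₀ ^ (p - 1) * g z₀ + z₀ ^ p * deriv g z₀ := by
    have hgd : HasDerivAt g (deriv g z₀) z₀ :=
      ((hg z₀ hz₀).differentiableAt (Metric.isOpen_ball.mem_nhds hz₀)).hasDerivAt
    have h1 := (hasDerivAt_pow p z₀).mul hgd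
    have : f =ᶠ[nhds z₀] fun z => z ^ p * g z := by
      filter_upwards [Metric.isOpen_ball.mem_nhds hz₀] with z hz using hfg z hz
    rw [this.deriv_eq]
    exact h1.deriv
  have hq : z₀ * deriv f z₀ / f z₀ = p + (z₀ * deriv g z₀) / g z₀ := by
    rw [hfd, hfg z₀ hz₀]
    obtain ⟨q, rfl⟩ : ∃ q, p = q + 1 := ⟨p - 1, by omega⟩
    simp only [Nat.add_sub_cancel]
    field_simp
    ring
  have hs := hstar z₀ hz₀ hz0
  rw [hq, Complex.add_re, Complex.natCast_re, Complex.div_re, him, Complex.normSq_apply, hre₀] at hs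
  set D := (z₀ * deriv g z₀).re
  set y := (g z₀).im
  have hK : 0 < 2 * (1 - γ) + b := by linarith
  have hN : 0 < γ * γ + y * y := by nlinarith [mul_pos hγ0 hγ0, mul_self_nonneg y]
  have hs2 : (β - p) * (γ * γ + y * y) < D * γ := by
    have : β - p < D * γ / (γ * γ + y * y) := by
      simp only [zero_mul, zero_div, add_zero] at hs
      linarith
    rwa [lt_div_iff₀ hN] at this
  have hs3 := mul_lt_mul_of_pos_right hs2 hK
  have hD2 := mul_le_mul_of_nonneg_left hD hγ0.le
  by_cases hγ : γ ≤ 1 / 2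
  · rw [if_pos hγ] at hβ
    have e : (β - p) * (2 * (1 - γ) + b) = - (2 * γ) := by rw [hβ]; field_simp; ring
    have e2 : (β - p) * (γ * γ + y * y) * (2 * (1 - γ) + b) = - (2 * γ) * (γ * γ + y * y) := by
      rw [← e]; ring
    rw [e2] at hs3
    nlinarith [mul_nonneg hγ0.le (by linarith : 0 ≤ 1 - 2 * γ)]
  · rw [if_neg hγ] at hβ
    push Not at hγ
    have e : (β - p) * (2 * (1 - γ) + b) * γ = - (2 * (1 - γ) ^ 2) := by
      rw [hβ]; field_simp; ring
    have e2 : (β - p) * (γ * γ + y * y) * (2 * (1 - γ) + b) * γ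
        = - (2 * (1 - γ) ^ 2) * (γ * γ + y * y) := by
      rw [← e]; ring
    have hs4 := mul_lt_mul_of_pos_right hs3 hγ0
    rw [e2] at hs4
    have hD3 := mul_le_mul_of_nonneg_left hD2 hγ0.le
    nlinarith [mul_nonneg (mul_self_nonneg y) (by linarith : 0 ≤ 2 * γ - 1)]
end

section
/- Let p ∈ ℕ (p ≥ 1), 0 ≤ β < 1 and 0 ≤ (p+1)b ≤ 4p(1−β). Set α = p − 8pβ/(4p(1−β)+(p+1)b) if 0 ≤ β ≤ 1/2, and α = p − 8p(1−β)²/(β(4p(1−β)+(p+1)b)) if 1/2 ≤ β < 1. If f ∈ 𝒜_{p,b} satisfies f'(z) ≠ 0 for all z ∈ 𝔻 \ {0} and Re(1 + z f''(z)/f'(z)) > α for all z ∈ 𝔻 \ {0}, then Re √(f'(z)/(p z^{p−1})) > β for all z ∈ 𝔻. -/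
lemma schwarz_fixed (w : ℂ → ℂ) (r μ : ℝ) (hr : 0 < r) (hμ : 0 ≤ μ) (ha : r * μ < 1)
    (hw : DifferentiableOn ℂ w (Metric.ball 0 r)) (hw0 : w 0 = 0)
    (hb : ∀ z ∈ Metric.ball (0 : ℂ) r, ‖w z‖ ≤ 1) (hd : deriv w 0 = (μ : ℂ))
    (z : ℂ) (hz : z ∈ Metric.ball (0 : ℂ) r) :
    ‖w z‖ * (1 + r * μ * (‖z‖ / r)) ≤ ‖z‖ / r * (‖z‖ / r + r * μ) := by
  set a := r * μ with ha_def
  have ha0 : 0 ≤ a := by positivity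
  have hφd : DifferentiableOn ℂ (fun z => (r : ℂ) * dslope w 0 z) (Metric.ball 0 r) :=
    ((Complex.differentiableOn_dslope (Metric.ball_mem_nhds 0 hr)).2 hw).const_mul _
  set φ := fun z => (r : ℂ) * dslope w 0 z with hφ
  have hφ0 : φ 0 = a := by simp [hφ, hd, ha_def]
  have hφb : ∀ z ∈ Metric.ball (0 : ℂ) r, ‖φ z‖ ≤ 1 := by
    intro z hz
    have := Complex.norm_dslope_le_div_of_mapsTo_ball (R₂ := 1) hw
      (by intro x hx; simpa [hw0] using hb x hx) hz
    simp only [hφ, norm_mul, Complex.norm_real, Real.norm_eq_abs, abs_of_pos hr]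
    rw [le_div_iff₀ hr] at this
    linarith
  have hden : ∀ z ∈ Metric.ball (0 : ℂ) r, 1 - (a : ℂ) * φ z ≠ 0 := by
    intro z hz h
    have h1 : (a : ℂ) * φ z = 1 := by linear_combination -h
    have h2 := congrArg norm h1
    simp only [norm_mul, Complex.norm_real, Real.norm_eq_abs, abs_of_nonneg ha0, norm_one] at h2
    nlinarith [hφb z hz]
  have hψd : DifferentiableOn ℂ (fun z => (φ z - a) / (1 - a * φ z)) (Metric.ball 0 r) :=
    (hφd.sub_const _).div ((differentiableOn_const _).sub (hφd.const_mul _)) hden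
  have key := Complex.dist_le_div_mul_dist_of_mapsTo_ball (R₂ := 1) hψd (by
    intro x hx
    simp only [hφ0, sub_self, zero_div, Metric.mem_closedBall, dist_zero_right]
    rw [norm_div]
    apply div_le_one_of_le₀ _ (norm_nonneg _)
    apply le_of_sq_le_sq _ (norm_nonneg _)
    have h1 := hφb x hx
    have h2 : ‖φ x‖ ^ 2 ≤ 1 := by nlinarith [norm_nonneg (φ x)]
    rw [← Complex.normSq_eq_norm_sq, Complex.normSq_apply] at h2 ⊢
    rw [← Complex.normSq_eq_norm_sq, Complex.normSq_apply]
    simp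
    nlinarith [mul_nonneg (sub_nonneg.2 h2) (by nlinarith : 0 ≤ 1 - a ^ 2)]) hz
  simp only [hφ0, sub_self, zero_div, dist_zero_right, norm_div] at key
  have hdz := norm_pos_iff.2 (hden z hz)
  rw [div_le_iff₀ hdz] at key
  set t := ‖z‖ / r with ht
  have ht0 : 0 ≤ t := by positivity
  have ht1 : t < 1 := by rw [ht, div_lt_one hr]; simpa using hz
  have key2 : ‖φ z - a‖ ≤ t * ‖1 - a * φ z‖ := by
    refine key.trans_eq ?_
    rw [ht]; ring
  have hx := hφb z hz
  have hx0 := norm_nonneg (φ z)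
  have hxn : ‖φ z‖ ^ 2 = (φ z).re * (φ z).re + (φ z).im * (φ z).im := by
    rw [← Complex.normSq_eq_norm_sq, Complex.normSq_apply]
  have hre := Complex.re_le_norm (φ z)
  have k3 : ‖φ z - a‖ ^ 2 ≤ t ^ 2 * ‖1 - a * φ z‖ ^ 2 := by
    rw [← mul_pow]; exact pow_le_pow_left₀ (norm_nonneg _) key2 2
  rw [← Complex.normSq_eq_norm_sq, Complex.normSq_apply, ← Complex.normSq_eq_norm_sq,
    Complex.normSq_apply] at k3
  simp at k3
  have ht2 : 0 ≤ 1 - t ^ 2 := by nlinarith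
  have k4 : (‖φ z‖ - a) ^ 2 ≤ (t * (1 - a * ‖φ z‖)) ^ 2 := by
    have e1 : a ^ 2 * t ^ 2 * ‖φ z‖ ^ 2
        = a ^ 2 * t ^ 2 * ((φ z).re * (φ z).re + (φ z).im * (φ z).im) := by rw [hxn]
    have e2 := mul_nonneg (mul_nonneg ha0 ht2) (sub_nonneg.2 hre)
    linarith
  have hax : 0 ≤ 1 - a * ‖φ z‖ := by nlinarith
  have k5 := abs_le_of_sq_le_sq k4 (by positivity)
  have k6 := (abs_le.1 k5).2
  have hwz : ‖w z‖ = t * ‖φ z‖ := by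
    have h := sub_smul_dslope w 0 z
    rw [hw0, sub_zero, sub_zero] at h
    rw [← h, norm_smul, hφ, norm_mul, Complex.norm_real, Real.norm_eq_abs, abs_of_pos hr, ht]
    field_simp
  rw [hwz, mul_assoc]
  apply mul_le_mul_of_nonneg_left _ ht0
  linarith

lemma core_boundary (s : ℂ → ℂ) (β μ : ℝ) (hβ : β < 1) (hμ0 : 0 ≤ μ) (hμ1 : μ ≤ 1)
    (hs : DifferentiableOn ℂ s (Metric.ball 0 1)) (hs0 : s 0 = 1)
    (hsd : deriv s 0 = 2 * (1 - β) * μ)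
    (z : ℂ) (hz : ‖z‖ < 1) (hz0 : z ≠ 0)
    (hlt : ∀ x, ‖x‖ < ‖z‖ → β < (s x).re) (hzr : (s z).re ≤ β) :
    (s z).re = β ∧ (z * deriv s z).im = 0 ∧
    (z * deriv s z).re * ((1 + μ) * (1 - β)) ≤ -((1 - β) ^ 2 + (s z).im ^ 2) := by
  have hr : 0 < ‖z‖ := norm_pos_iff.2 hz0
  have hsa : ∀ x, ‖x‖ < 1 → DifferentiableAt ℂ s x := fun x hx =>
    hs.differentiableAt (Metric.isOpen_ball.mem_nhds (by simpa using hx))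
  have hge : ∀ x, ‖x‖ ≤ ‖z‖ → β ≤ (s x).re := by
    intro x hx
    have hxc : x ∈ closure (Metric.ball (0 : ℂ) ‖z‖) := by
      rw [closure_ball _ hr.ne']; simpa using hx
    have hc : ContinuousWithinAt (fun y => (s y).re) (Metric.ball (0 : ℂ) ‖z‖) x :=
      (Complex.continuous_re.continuousAt.comp
        (hsa x (hx.trans_lt hz)).continuousAt).continuousWithinAt
    have := hc.mem_closure_image hxc
    have h2 : closure ((fun y => (s y).re) '' (Metric.ball (0 : ℂ) ‖z‖)) ⊆ Set.Ici β := by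
      apply closure_minimal _ isClosed_Ici
      rintro _ ⟨y, hy, rfl⟩
      exact (hlt y (by simpa using hy)).le
    exact h2 this
  have hre : (s z).re = β := le_antisymm hzr (hge z le_rfl)
  refine ⟨hre, ?_, ?_⟩
  · -- tangential
    have h1 : HasDerivAt (fun t : ℝ => z * Complex.exp (t * Complex.I)) (z * Complex.I) 0 := by
      have : HasDerivAt (fun t : ℂ => z * Complex.exp (t * Complex.I))
          (z * (Complex.exp ((0 : ℝ) * Complex.I) * (1 * Complex.I))) ((0 : ℝ) : ℂ) :=
        ((((hasDerivAt_id _).mul_const _).cexp)).const_mul z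
      simpa using this.comp_ofReal
    have h2 : HasDerivAt (fun t : ℝ => s (z * Complex.exp (t * Complex.I)))
        (deriv s z * (z * Complex.I)) 0 := by
      have hh : HasDerivAt s (deriv s z) (z * Complex.exp (((0 : ℝ) : ℂ) * Complex.I)) := by
        simpa using (hsa z hz).hasDerivAt
      exact HasDerivAt.comp (0 : ℝ) hh h1
    have h3 : HasDerivAt (fun t : ℝ => (s (z * Complex.exp (t * Complex.I))).re)
        (deriv s z * (z * Complex.I)).re 0 :=
      (Complex.reCLM.hasFDerivAt.comp_hasDerivAt (0 : ℝ) h2)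
    have h4 : IsLocalMin (fun t : ℝ => (s (z * Complex.exp (t * Complex.I))).re) 0 := by
      apply Filter.Eventually.of_forall
      intro t
      simp only [Complex.ofReal_zero, zero_mul, Complex.exp_zero, mul_one, hre]
      apply hge
      rw [norm_mul, Complex.norm_exp_ofReal_mul_I, mul_one]
    have h5 := h4.hasDerivAt_eq_zero h3
    simp at h5 ⊢
    linarith
  · -- radial
    set a := ‖z‖ * μ with ha_def
    have ha0 : 0 ≤ a := by positivity
    have ha1 : a < 1 := by nlinarith
    have hid : ∀ u : ℂ, ‖u + 1 - 2 * β‖ ^ 2 - ‖u - 1‖ ^ 2 = 4 * (1 - β) * (u.re - β) := by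
      intro u
      rw [← Complex.normSq_eq_norm_sq, ← Complex.normSq_eq_norm_sq, Complex.normSq_apply,
        Complex.normSq_apply]
      simp
      ring
    have hden : ∀ x ∈ Metric.ball (0 : ℂ) ‖z‖, s x + 1 - 2 * β ≠ 0 := by
      intro x hx h
      have h1 := hlt x (by simpa using hx)
      have h2 := hid (s x)
      rw [h] at h2
      have : 0 < 4 * (1 - β) * ((s x).re - β) := by
        apply mul_pos <;> linarith
      simp at h2
      nlinarith [sq_nonneg ‖s x - 1‖]
    have hsb : DifferentiableOn ℂ s (Metric.ball 0 ‖z‖) :=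
      hs.mono (Metric.ball_subset_ball hz.le)
    have hβ' : (1 : ℂ) - β ≠ 0 := by
      intro h
      have : (1 : ℝ) - β = 0 := by exact_mod_cast h
      linarith
    have hS := schwarz_fixed (fun x => (s x - 1) / (s x + 1 - 2 * β)) ‖z‖ μ hr hμ0 ha1
      ((hsb.sub_const _).div ((hsb.add_const _).sub_const _) hden) (by simp [hs0])
      (by
        intro x hx
        rw [norm_div]
        apply div_le_one_of_le₀ _ (norm_nonneg _)
        apply le_of_sq_le_sq _ (norm_nonneg _)
        have h1 := hlt x (by simpa using hx)
        have h2 := hid (s x)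
        have : 0 < 4 * (1 - β) * ((s x).re - β) := by
          apply mul_pos <;> linarith
        linarith)
      (by
        have hd0 := (hsa 0 (by simp)).hasDerivAt
        have := (hd0.sub_const 1).div ((hd0.add_const 1).sub_const (2 * (β : ℂ)))
          (hden 0 (by simpa using hz0))
        have h9 := this.deriv
        refine Eq.trans h9 ?_
        rw [hs0, hsd]
        have : (1 : ℂ) + 1 - 2 * β ≠ 0 := by
          rw [show (1 : ℂ) + 1 - 2 * β = 2 * (1 - β) by ring]
          exact mul_ne_zero two_ne_zero hβ'
        field_simp
        ring)
    -- the function N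
    have hg : HasDerivAt (fun t : ℝ => s (t * z)) (z * deriv s z) 1 := by
      have h1 : HasDerivAt (fun t : ℂ => t * z) (1 * z) ((1 : ℝ) : ℂ) :=
        (hasDerivAt_id _).mul_const z
      have hh : HasDerivAt s (deriv s z) (((1 : ℝ) : ℂ) * z) := by
        simpa using (hsa z hz).hasDerivAt
      have := HasDerivAt.comp (1 : ℝ) hh h1.comp_ofReal
      rw [one_mul, mul_comm] at this
      exact this
    have hσ : HasDerivAt (fun t : ℝ => (s (t * z)).re) (z * deriv s z).re 1 :=
      Complex.reCLM.hasFDerivAt.comp_hasDerivAt (1 : ℝ) hg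
    have hτ : HasDerivAt (fun t : ℝ => (s (t * z)).im) (z * deriv s z).im 1 :=
      Complex.imCLM.hasFDerivAt.comp_hasDerivAt (1 : ℝ) hg
    have hid1 := hasDerivAt_id (1 : ℝ)
    have hN := (((hid1.mul (hid1.add_const a)).pow 2).mul
        (((hσ.add_const (1 - 2 * β)).pow 2).add (hτ.pow 2))).sub
      ((((hid1.const_mul a).const_add 1).pow 2).mul
        (((hσ.sub_const 1).pow 2).add (hτ.pow 2)))
    have hle := (hasDerivWithinAt_iff_tendsto_slope' (s := Set.Iio (1 : ℝ)) (by simp)).1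
      (hN.hasDerivWithinAt)
    have hfin := le_of_tendsto (b := 0) hle (by
      have : Set.Ioo (0 : ℝ) 1 ∈ nhdsWithin (1 : ℝ) (Set.Iio 1) :=
        Ioo_mem_nhdsLT (by norm_num)
      filter_upwards [this] with t ht
      have hnz : ‖(t : ℂ) * z‖ = t * ‖z‖ := by
        rw [norm_mul, Complex.norm_real, Real.norm_eq_abs, abs_of_pos ht.1]
      have hmem : (t : ℂ) * z ∈ Metric.ball (0 : ℂ) ‖z‖ := by
        simp only [Metric.mem_ball, dist_zero_right, hnz]
        nlinarith [ht.2]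
      have h1 := hS _ hmem
      rw [hnz, mul_div_assoc, div_self hr.ne', mul_one, norm_div, ← ha_def,
        div_mul_eq_mul_div, div_le_iff₀ (norm_pos_iff.2 (hden _ hmem))] at h1
      have h2 := pow_le_pow_left₀ (by have := ht.1; positivity) h1 2
      rw [mul_pow, mul_pow _ ‖_‖, ← Complex.normSq_eq_norm_sq, Complex.normSq_apply,
        ← Complex.normSq_eq_norm_sq, Complex.normSq_apply] at h2
      simp only [Complex.sub_re, Complex.sub_im, Complex.add_re, Complex.add_im, Complex.one_re,
        Complex.one_im, Complex.mul_re, Complex.mul_im, Complex.re_ofNat, Complex.im_ofNat,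
        Complex.ofReal_re, Complex.ofReal_im] at h2
      rw [slope_def_field]
      apply div_nonpos_of_nonneg_of_nonpos _ (by linarith [ht.2])
      simp [hre]
      nlinarith [h2])
    simp [hre] at hfin
    set D := z * deriv s z
    set y := (s z).im
    have hDre : D.re = z.re * (deriv s z).re - z.im * (deriv s z).im := Complex.mul_re _ _
    rw [← hDre] at hfin
    have h1 : (1 + a) * ((1 + a) * (1 - β) * D.re + ((1 - β) ^ 2 + y ^ 2)) ≤ 0 := by
      nlinarith [hfin]
    have h2 : (1 + a) * (1 - β) * D.re + ((1 - β) ^ 2 + y ^ 2) ≤ 0 := by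
      by_contra h
      push Not at h
      have := mul_pos (by linarith : 0 < 1 + a) h
      linarith
    have hneg : (1 - β) * D.re ≤ 0 := by
      by_contra h
      push Not at h
      have := mul_pos (by linarith : 0 < 1 + a) h
      nlinarith [sq_nonneg (1 - β), sq_nonneg y]
    have haμ : a ≤ μ := by nlinarith
    nlinarith [mul_nonneg (sub_nonneg.2 haμ) (neg_nonneg.2 hneg)]

lemma stmt_8_aux (p : ℕ) (hp : 1 ≤ p) (b : ℝ)
    (f g : ℂ → ℂ) (hg : DifferentiableOn ℂ g (Metric.ball 0 1)) (hg0 : g 0 = 1)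
    (hgb : deriv g 0 = (b : ℂ))
    (hfg : ∀ z ∈ Metric.ball (0 : ℂ) 1, f z = z ^ p * g z)
    (s : ℂ → ℂ) (hs : DifferentiableOn ℂ s (Metric.ball 0 1)) (hs0 : s 0 = 1)
    (hs2 : ∀ z ∈ Metric.ball (0 : ℂ) 1, z ≠ 0 →
      (s z) ^ 2 = deriv f z / ((p : ℂ) * z ^ (p - 1))) :
    deriv s 0 = ((p : ℂ) + 1) * b / (2 * p) := by
  obtain ⟨q, rfl⟩ : ∃ q, p = q + 1 := ⟨p - 1, by omega⟩
  have hq : ((q + 1 : ℕ) : ℂ) ≠ 0 := by exact_mod_cast Nat.succ_ne_zero q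
  have hball : Metric.ball (0 : ℂ) 1 ∈ nhds (0 : ℂ) := Metric.ball_mem_nhds 0 one_pos
  have hg' : DifferentiableOn ℂ (deriv g) (Metric.ball 0 1) := hg.deriv Metric.isOpen_ball
  have hsq : ∀ z ∈ Metric.ball (0 : ℂ) 1,
      s z ^ 2 = g z + z * deriv g z / ((q + 1 : ℕ) : ℂ) := by
    intro z hz
    by_cases h0 : z = 0
    · simp [h0, hs0, hg0]
    have hnz : Metric.ball (0 : ℂ) 1 ∈ nhds z := Metric.isOpen_ball.mem_nhds hz
    have h1 : f =ᶠ[nhds z] fun z => z ^ (q + 1) * g z := by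
      filter_upwards [hnz] with x hx using hfg x hx
    have h2 := ((hasDerivAt_pow (q + 1) z).mul (hg.differentiableAt hnz).hasDerivAt)
    have h3 : deriv f z = _ := (h2.congr_of_eventuallyEq h1).deriv
    rw [hs2 z hz h0, h3]
    simp only [Nat.add_sub_cancel]
    field_simp
    ring
  have e1 : (fun z => s z ^ 2) =ᶠ[nhds 0]
      fun z => g z + z * deriv g z / ((q + 1 : ℕ) : ℂ) := by
    filter_upwards [hball] with x hx using hsq x hx
  have d1 := ((hs.differentiableAt hball).hasDerivAt.pow 2).deriv
  have d2 := ((hg.differentiableAt hball).hasDerivAt.add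
    (((hasDerivAt_id (0 : ℂ)).mul (hg'.differentiableAt hball).hasDerivAt).div_const
      ((q + 1 : ℕ) : ℂ))).deriv
  have e2 := e1.deriv_eq
  have e3 := d1.symm.trans (e2.trans d2)
  simp only [hs0, hgb, id] at e3
  norm_num at e3
  rw [eq_div_iff (mul_ne_zero two_ne_zero hq)]
  have hq' : (q : ℂ) + 1 ≠ 0 := by exact_mod_cast hq
  field_simp at e3
  push_cast
  linear_combination e3

lemma stmt_8_log (p : ℕ) (hp : 1 ≤ p) (f s : ℂ → ℂ)
    (hs : DifferentiableOn ℂ s (Metric.ball 0 1))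
    (hs2 : ∀ z ∈ Metric.ball (0 : ℂ) 1, z ≠ 0 →
      (s z) ^ 2 = deriv f z / ((p : ℂ) * z ^ (p - 1)))
    (z : ℂ) (hz : z ∈ Metric.ball (0 : ℂ) 1) (hz0 : z ≠ 0) (hsz : s z ≠ 0) :
    1 + z * deriv (deriv f) z / deriv f z = p + 2 * (z * deriv s z / s z) := by
  obtain ⟨q, rfl⟩ : ∃ q, p = q + 1 := ⟨p - 1, by omega⟩
  have hq : ((q + 1 : ℕ) : ℂ) ≠ 0 := by exact_mod_cast Nat.succ_ne_zero q
  simp only [Nat.add_sub_cancel] at hs2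
  have hnz : Metric.ball (0 : ℂ) 1 ∈ nhds z := Metric.isOpen_ball.mem_nhds hz
  have hF : ∀ x ∈ Metric.ball (0 : ℂ) 1, x ≠ 0 →
      deriv f x = ((q + 1 : ℕ) : ℂ) * (x ^ q * s x ^ 2) := by
    intro x hx hx0
    rw [hs2 x hx hx0]
    field_simp
  have h1 : deriv f =ᶠ[nhds z] fun x => ((q + 1 : ℕ) : ℂ) * (x ^ q * s x ^ 2) := by
    filter_upwards [hnz, isOpen_ne.mem_nhds hz0] with x hx hx0 using hF x hx hx0
  have h2 := (((hasDerivAt_pow q z).mul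
    ((hs.differentiableAt hnz).hasDerivAt.pow 2)).const_mul ((q + 1 : ℕ) : ℂ))
  have h3 : deriv (deriv f) z = _ := (h2.congr_of_eventuallyEq h1).deriv
  rw [h3, hF z hz hz0]
  have hzq : (q : ℂ) * z ^ (q - 1) * z = q * z ^ q := by
    cases q with
    | zero => simp
    | succ n => simp [pow_succ, mul_assoc]
  have hzq0 : z ^ q ≠ 0 := pow_ne_zero _ hz0
  simp only [Pi.pow_apply]
  have : z * (((q + 1 : ℕ) : ℂ) * (↑q * z ^ (q - 1) * s z ^ 2 +
      z ^ q * (((2 : ℕ) : ℂ) * s z ^ (2 - 1) * deriv s z)))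
      = ((q + 1 : ℕ) : ℂ) * (q * z ^ q * s z ^ 2 + z * z ^ q * (2 * s z * deriv s z)) := by
    rw [← hzq]; push_cast; norm_num; ring
  rw [this]
  field_simp
  push_cast
  ring

/-- Theorem 3.5: for `f ∈ 𝒜_{p,b}` with `0 ≤ (p+1)b ≤ 4p(1-β)`,
`Re(1 + z f''/f') > α` on the punctured disk implies `Re √(f'(z)/(p z^(p-1))) > β`
on the disk, with `α` as specified. -/
theorem stmt_8 (p : ℕ) (hp : 1 ≤ p) (β b α : ℝ) (hβ0 : 0 ≤ β) (hβ1 : β < 1)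
    (hb0 : 0 ≤ ((p : ℝ) + 1) * b) (hb1 : ((p : ℝ) + 1) * b ≤ 4 * (p : ℝ) * (1 - β))
    (hα : α = if β ≤ 1 / 2 then
        (p : ℝ) - 8 * (p : ℝ) * β / (4 * (p : ℝ) * (1 - β) + ((p : ℝ) + 1) * b)
      else (p : ℝ) - 8 * (p : ℝ) * (1 - β) ^ 2 / (β * (4 * (p : ℝ) * (1 - β) + ((p : ℝ) + 1) * b)))
    (f g : ℂ → ℂ) (hg : DifferentiableOn ℂ g (Metric.ball 0 1)) (hg0 : g 0 = 1)
    (hgb : deriv g 0 = (b : ℂ))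
    (hfg : ∀ z ∈ Metric.ball (0 : ℂ) 1, f z = z ^ p * g z)
    (hf' : ∀ z ∈ Metric.ball (0 : ℂ) 1, z ≠ 0 → deriv f z ≠ 0)
    (hconv : ∀ z ∈ Metric.ball (0 : ℂ) 1, z ≠ 0 →
      α < (1 + z * deriv (deriv f) z / deriv f z).re)
    (s : ℂ → ℂ) (hs : DifferentiableOn ℂ s (Metric.ball 0 1)) (hs0 : s 0 = 1)
    (hs2 : ∀ z ∈ Metric.ball (0 : ℂ) 1, z ≠ 0 →
      (s z) ^ 2 = deriv f z / ((p : ℂ) * z ^ (p - 1))) :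
    ∀ z ∈ Metric.ball (0 : ℂ) 1, β < (s z).re := by
  intro z1 hz1
  by_contra hcon
  push Not at hcon
  have hP : (1 : ℝ) ≤ p := by exact_mod_cast hp
  have hb' : 0 < 1 - β := by linarith
  have hz1' : ‖z1‖ < 1 := by simpa using hz1
  -- first contact point
  have hcb : Metric.closedBall (0 : ℂ) ‖z1‖ ⊆ Metric.ball 0 1 :=
    Metric.closedBall_subset_ball hz1'
  have hK : IsCompact (Metric.closedBall (0 : ℂ) ‖z1‖ ∩ (fun x => (s x).re) ⁻¹' Set.Iic β) := by
    apply IsCompact.of_isClosed_subset (isCompact_closedBall (0 : ℂ) ‖z1‖) _ Set.inter_subset_left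
    exact (Complex.continuous_re.comp_continuousOn
      (hs.continuousOn.mono hcb)).preimage_isClosed_of_isClosed Metric.isClosed_closedBall
        isClosed_Iic
  obtain ⟨z, ⟨hzc, hzβ⟩, hmin⟩ := hK.exists_isMinOn ⟨z1, by simp, hcon⟩
    (continuous_norm.continuousOn)
  have hzβ : (s z).re ≤ β := hzβ
  have hzle : ‖z‖ ≤ ‖z1‖ := by simpa using hzc
  have hz : ‖z‖ < 1 := hzle.trans_lt hz1'
  have hzb : z ∈ Metric.ball (0 : ℂ) 1 := by simpa using hz
  have hz0 : z ≠ 0 := by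
    rintro rfl
    simp [hs0] at hzβ
    linarith
  have hlt : ∀ x, ‖x‖ < ‖z‖ → β < (s x).re := by
    intro x hx
    by_contra h
    push Not at h
    have := hmin (show x ∈ _ from ⟨by simpa using hx.le.trans hzle, h⟩)
    have : ‖z‖ ≤ ‖x‖ := this
    linarith
  set μ : ℝ := ((p : ℝ) + 1) * b / (4 * p * (1 - β)) with hμ
  have h4 : 0 < 4 * (p : ℝ) * (1 - β) := by positivity
  have hμb : ((p : ℝ) + 1) * b = 4 * p * (1 - β) * μ := by
    rw [hμ]; field_simp
  have hμ0 : 0 ≤ μ := by positivity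
  have hμ1 : μ ≤ 1 := by rw [hμ, div_le_one h4]; exact hb1
  have hpc : (p : ℂ) ≠ 0 := by exact_mod_cast (by omega : p ≠ 0)
  have hsd : deriv s 0 = 2 * (1 - β) * μ := by
    rw [stmt_8_aux p hp b f g hg hg0 hgb hfg s hs hs0 hs2]
    have hc : ((p : ℂ) + 1) * b = 4 * p * (1 - β) * μ := by exact_mod_cast hμb
    rw [hc]
    field_simp
    ring
  obtain ⟨hre, him, hD⟩ := core_boundary s β μ hβ1 hμ0 hμ1 hs hs0 hsd z hz hz0 hlt hzβ
  have hsz : s z ≠ 0 := by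
    intro h
    have := hs2 z hzb hz0
    rw [h] at this
    have h2 : deriv f z / ((p : ℂ) * z ^ (p - 1)) ≠ 0 :=
      div_ne_zero (hf' z hzb hz0) (mul_ne_zero hpc (pow_ne_zero _ hz0))
    apply h2
    rw [← this]; simp
  have hc := hconv z hzb hz0
  rw [stmt_8_log p hp f s hs hs2 z hzb hz0 hsz] at hc
  set D := z * deriv s z
  set y := (s z).im
  have hn : 0 < β ^ 2 + y ^ 2 := by
    have := Complex.normSq_pos.2 hsz
    rw [Complex.normSq_apply, hre] at this
    nlinarith
  have hquot : (D / s z).re = D.re * β / (β ^ 2 + y ^ 2) := by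
    rw [Complex.div_re, Complex.normSq_apply, hre, him]
    simp only [zero_mul, zero_div, add_zero, ← pow_two]
    rfl
  have hc2 : α - p < 2 * (D.re * β / (β ^ 2 + y ^ 2)) := by
    rw [← hquot]
    have : ((p : ℂ) + 2 * (D / s z)).re = p + 2 * (D / s z).re := by simp
    rw [this] at hc
    linarith
  have hD2 : D.re ≤ -((1 - β) ^ 2 + y ^ 2) / ((1 + μ) * (1 - β)) := by
    rw [le_div_iff₀ (by positivity)]; exact hD
  have hc3 : α - p < -(2 * β * ((1 - β) ^ 2 + y ^ 2) / ((1 + μ) * (1 - β) * (β ^ 2 + y ^ 2))) := by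
    refine hc2.trans_le ?_
    have : D.re * β / (β ^ 2 + y ^ 2)
        ≤ -((1 - β) ^ 2 + y ^ 2) / ((1 + μ) * (1 - β)) * β / (β ^ 2 + y ^ 2) := by gcongr
    refine (mul_le_mul_of_nonneg_left this zero_le_two).trans_eq ?_
    field_simp
  rw [hα, hμb] at hc3
  split_ifs at hc3 with hβh
  · have e : 8 * (p : ℝ) * β / (4 * p * (1 - β) + 4 * p * (1 - β) * μ)
        = 2 * β / ((1 + μ) * (1 - β)) := by
      field_simp
      ring
    rw [e] at hc3
    have : 2 * β / ((1 + μ) * (1 - β)) ≤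
        2 * β * ((1 - β) ^ 2 + y ^ 2) / ((1 + μ) * (1 - β) * (β ^ 2 + y ^ 2)) := by
      rw [mul_div_mul_comm (2 * β) ((1 - β) ^ 2 + y ^ 2)]
      apply le_mul_of_one_le_right (by positivity)
      rw [one_le_div hn]
      nlinarith
    linarith
  · push Not at hβh
    have hβp : 0 < β := by linarith
    have e : 8 * (p : ℝ) * (1 - β) ^ 2 / (β * (4 * p * (1 - β) + 4 * p * (1 - β) * μ))
        = 2 * β / ((1 + μ) * (1 - β)) * ((1 - β) ^ 2 / β ^ 2) := by
      field_simp
      ring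
    rw [e] at hc3
    have : 2 * β / ((1 + μ) * (1 - β)) * ((1 - β) ^ 2 / β ^ 2) ≤
        2 * β * ((1 - β) ^ 2 + y ^ 2) / ((1 + μ) * (1 - β) * (β ^ 2 + y ^ 2)) := by
      rw [mul_div_mul_comm (2 * β)]
      apply mul_le_mul_of_nonneg_left _ (by positivity)
      rw [div_le_div_iff₀ (by positivity) hn]
      have : (1 - β) ^ 2 ≤ β ^ 2 := by nlinarith
      nlinarith [mul_nonneg (sub_nonneg.2 this) (sq_nonneg y)]
    linarith
end

section
/- Let p ∈ ℕ (p ≥ 1) and 0 ≤ (p+1)b ≤ 2p. If f ∈ 𝒜_{p,b} satisfies f'(z) ≠ 0 for all z ∈ 𝔻 \ {0} and Re(1 + z f''(z)/f'(z)) > p − 4p/(2p+(p+1)b) for all z ∈ 𝔻 \ {0}, then Re √(f'(z)/(p z^{p−1})) > 1/2 for all z ∈ 𝔻. -/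
open Metric Set Filter Topology ComplexConjugate

lemma aux_left_s9 (F : ℝ → ℝ) (D : ℝ) (h : HasDerivAt F D 1) (h1 : F 1 = 0)
    (hF : ∀ t : ℝ, 0 < t → t < 1 → 0 ≤ F t) : D ≤ 0 := by
  have h2 := (hasDerivAt_iff_tendsto_slope.1 h).mono_left
    (nhdsWithin_mono (1:ℝ) (show Iio (1:ℝ) ⊆ {1}ᶜ from fun x hx => ne_of_lt hx))
  refine le_of_tendsto h2 ?_
  filter_upwards [Ioo_mem_nhdsLT (show (0:ℝ) < 1 by norm_num)] with t ht
  rw [slope_def_field, h1]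
  exact div_nonpos_of_nonneg_of_nonpos (by linarith [hF t ht.1 ht.2]) (by linarith [ht.2])

lemma aux_normSq (q c : ℂ) : ‖q - c‖ ^ 2 = ‖q‖ ^ 2 + ‖c‖ ^ 2 - 2 * (conj c * q).re ∧
    ‖1 - conj c * q‖ ^ 2 = 1 + ‖c‖ ^ 2 * ‖q‖ ^ 2 - 2 * (conj c * q).re := by
  simp only [← Complex.normSq_eq_norm_sq, Complex.normSq_apply]
  simp
  constructor <;> ring

lemma aux_pick_s9 (q : ℂ → ℂ) (hq : DifferentiableOn ℂ q (ball 0 1))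
    (hb : ∀ z ∈ ball (0:ℂ) 1, ‖q z‖ ≤ 1) (A : ℝ) (hA : ‖q 0‖ = A) (hA1 : A < 1)
    (t : ℝ) (h0 : 0 < t) (h1 : t < 1) : ‖q t‖ ≤ (t + A) / (1 + A * t) := by
  have hA0 : 0 ≤ A := hA ▸ norm_nonneg _
  have hne : ∀ z ∈ ball (0:ℂ) 1, 1 - conj (q 0) * q z ≠ 0 := by
    intro z hz h
    have : ‖conj (q 0) * q z‖ = 1 := by rw [← sub_eq_zero.1 h]; simp
    rw [norm_mul, Complex.norm_conj, hA] at this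
    nlinarith [hb z hz, norm_nonneg (q z)]
  have hle : ∀ z ∈ ball (0:ℂ) 1, ‖(q z - q 0) / (1 - conj (q 0) * q z)‖ ≤ 1 := by
    intro z hz
    rw [norm_div]
    apply div_le_one_of_le₀ _ (norm_nonneg _)
    have := aux_normSq (q z) (q 0)
    refine le_of_sq_le_sq ?_ (norm_nonneg _)
    rw [this.1, this.2, hA]
    nlinarith [mul_nonneg (show 0 ≤ 1 - ‖q z‖ ^ 2 by nlinarith [hb z hz, norm_nonneg (q z)])
      (show 0 ≤ 1 - A ^ 2 by nlinarith)]
  have ht : ‖(t:ℂ)‖ = t := by simp [abs_of_pos h0]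
  have htb : (t:ℂ) ∈ ball (0:ℂ) 1 := by rw [mem_ball_zero_iff, ht]; exact h1
  have key := Complex.norm_le_norm_of_mapsTo_ball
    (f := fun z => (q z - q 0) / (1 - conj (q 0) * q z)) (R := 1) (z := t)
    (by
      apply DifferentiableOn.div _ _ hne
      · exact hq.sub_const _
      · exact (hq.const_mul _).const_sub _)
    (by intro z hz; rw [mem_closedBall_zero_iff]; exact hle z hz)
    (by simp) (by rw [ht]; exact h1)
  simp only [norm_div] at key
  rw [ht, div_le_iff₀ (norm_pos_iff.2 (hne _ htb))] at key
  have hk2 := pow_le_pow_left₀ (norm_nonneg _) key 2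
  obtain ⟨e1, e2⟩ := aux_normSq (q t) (q 0)
  rw [mul_pow, e1, e2, hA] at hk2
  have hc : (conj (q 0) * q t).re ≤ A * ‖q t‖ := by
    refine (Complex.re_le_norm _).trans ?_
    rw [norm_mul, Complex.norm_conj, hA]
  have hx := hb _ htb
  have hx0 := norm_nonneg (q t)
  set x := ‖q t‖
  set c := (conj (q 0) * q t).re
  have h3 : (x - A) ^ 2 ≤ (t * (1 - A * x)) ^ 2 := by
    nlinarith [mul_nonneg (sub_nonneg.2 hc) (show 0 ≤ 1 - t ^ 2 by nlinarith)]
  have h4 : x - A ≤ t * (1 - A * x) := by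
    apply le_of_sq_le_sq h3
    apply mul_nonneg h0.le; nlinarith
  rw [le_div_iff₀ (by positivity)]
  linarith

lemma aux_jack_s9 (v : ℂ → ℂ) (hv : DifferentiableOn ℂ v (ball 0 1))
    (hb : ∀ z ∈ ball (0:ℂ) 1, ‖v z‖ < 1) (hv0 : v 0 = 0) (A : ℝ) (hA : ‖deriv v 0‖ = A)
    (hA1 : A < 1) (hc : ∀ z : ℂ, ‖z‖ = 1 → ‖v z‖ ≤ 1) (d : ℂ) (hd : HasDerivAt v d 1)
    (h1 : ‖v 1‖ = 1) : ∃ k : ℝ, 2 / (1 + A) ≤ k ∧ d = k * v 1 := by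
  have hA0 : 0 ≤ A := hA ▸ norm_nonneg _
  have hq : DifferentiableOn ℂ (dslope v 0) (ball 0 1) :=
    (Complex.differentiableOn_dslope (ball_mem_nhds _ one_pos)).2 hv
  have hmaps : MapsTo v (ball 0 1) (closedBall (v 0) 1) := by
    intro z hz; rw [hv0, mem_closedBall_zero_iff]; exact (hb z hz).le
  have hqb : ∀ z ∈ ball (0:ℂ) 1, ‖dslope v 0 z‖ ≤ 1 := by
    intro z hz
    simpa using Complex.norm_dslope_le_div_of_mapsTo_ball hv hmaps hz
  have hrad : ∀ t : ℝ, 0 < t → t < 1 → ‖v t‖ ≤ t * ((t + A) / (1 + A * t)) := by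
    intro t h0 h1
    have h2 := aux_pick_s9 _ hq hqb A (by simpa using hA) hA1 t h0 h1
    have ht : (t:ℂ) ≠ 0 := by exact_mod_cast h0.ne'
    have h3 : v t = t * dslope v 0 t := by
      rw [dslope_of_ne _ ht, slope_def_field, hv0]; field_simp; simp [mul_comm]
    rw [h3, norm_mul, Complex.norm_real, Real.norm_of_nonneg h0.le]
    exact mul_le_mul_of_nonneg_left h2 h0.le
  have hE : (conj (v 1) * d).im = 0 := by
    have hcurve : HasDerivAt (fun θ : ℝ => v (Complex.exp (θ * Complex.I))) (d * Complex.I) 0 := by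
      have e1 : HasDerivAt (fun θ : ℂ => Complex.exp (θ * Complex.I)) Complex.I ((0:ℝ):ℂ) := by
        simpa using (((hasDerivAt_id (((0:ℝ):ℂ))).mul_const Complex.I).cexp)
      have e2 : HasDerivAt v d (Complex.exp (((0:ℝ):ℂ) * Complex.I)) := by simpa using hd
      exact (e2.comp ((0:ℝ):ℂ) e1).comp_ofReal
    have hmax : IsLocalMax (fun θ : ℝ => ‖v (Complex.exp (θ * Complex.I))‖ ^ 2) 0 := by
      refine Filter.Eventually.of_forall fun θ => ?_
      have := hc _ (Complex.norm_exp_ofReal_mul_I θ)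
      simp only [Complex.ofReal_zero, zero_mul, Complex.exp_zero, h1]
      exact pow_le_pow_left₀ (norm_nonneg _) this 2
    have := hmax.hasDerivAt_eq_zero hcurve.norm_sq
    rw [Complex.inner] at this
    simp at this ⊢
    linarith
  have hR : 2 / (1 + A) ≤ (conj (v 1) * d).re := by
    have e1 : HasDerivAt (fun t : ℝ => v t) d 1 :=
      HasDerivAt.comp_ofReal (by simpa using hd)
    have e2 := e1.norm_sq
    rw [Complex.inner] at e2
    have e3 : HasDerivAt (fun t : ℝ => t * ((t + A) / (1 + A * t))) (2 / (1 + A)) 1 := by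
      have n : HasDerivAt (fun t : ℝ => t + A) 1 1 := (hasDerivAt_id (1:ℝ)).add_const A
      have m : HasDerivAt (fun t : ℝ => 1 + A * t) A 1 := by
        simpa using ((hasDerivAt_id (1:ℝ)).const_mul A).const_add 1
      have := (hasDerivAt_id (1:ℝ)).mul (n.div m (by simp; positivity))
      refine this.congr_deriv ?_
      simp
      have : 1 + A ≠ 0 := by positivity
      field_simp
      ring
    have e4 := (e3.pow 2).sub e2
    have := aux_left_s9 _ _ e4 (by
      have : 1 + A ≠ 0 := by positivity
      simp [h1]; rw [div_self this]; ring) (by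
      intro t h0 h1
      simp only [Pi.sub_apply, Pi.pow_apply, sub_nonneg]
      exact pow_le_pow_left₀ (norm_nonneg _) (hrad t h0 h1) 2)
    have h9 : 1 + A ≠ 0 := by positivity
    rw [mul_one, add_comm 1 A, div_self (by rwa [add_comm] at h9)] at this
    simp at this ⊢
    rw [add_comm 1 A]; linarith
  refine ⟨_, hR, ?_⟩
  have : (((conj (v 1) * d).re : ℝ) : ℂ) = conj (v 1) * d := by
    apply Complex.ext <;> simp only [Complex.ofReal_re, Complex.ofReal_im, hE]
  rw [this]
  have h5 : v 1 * conj (v 1) = 1 := by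
    rw [Complex.mul_conj, Complex.normSq_eq_norm_sq, h1]; simp
  linear_combination -d * h5

lemma aux_main (w : ℂ → ℂ) (hw : DifferentiableOn ℂ w (ball 0 1)) (hw0 : w 0 = 0)
    (a : ℝ) (ha0 : 0 ≤ a) (ha1 : a ≤ 1) (hda : deriv w 0 = a) (hne : ∀ z ∈ ball (0:ℂ) 1, w z ≠ 1)
    (hre : ∀ z ∈ ball (0:ℂ) 1, z ≠ 0 → -1 / (1 + a) < (z * deriv w z / (1 - w z)).re) :
    ∀ z ∈ ball (0:ℂ) 1, ‖w z‖ < 1 := by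
  intro z hz
  by_contra hcon
  push Not at hcon
  have hz1 : ‖z‖ < 1 := by simpa using hz
  have hsub : closedBall (0:ℂ) ‖z‖ ⊆ ball 0 1 := closedBall_subset_ball hz1
  have hcont : ContinuousOn w (closedBall 0 ‖z‖) := hw.continuousOn.mono hsub
  have hK : IsCompact (closedBall (0:ℂ) ‖z‖ ∩ (fun x => ‖w x‖) ⁻¹' Ici 1) :=
    (isCompact_closedBall _ _).of_isClosed_subset
      (hcont.norm.preimage_isClosed_of_isClosed isClosed_closedBall isClosed_Ici) inter_subset_left
  obtain ⟨z0, ⟨hz0, hz0'⟩, hmin⟩ := hK.exists_isMinOn ⟨z, by simp, hcon⟩ continuous_norm.continuousOn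
  have hz0b := hsub hz0
  have hr1 : ‖z0‖ < 1 := by simpa using hz0b
  have hlt : ∀ x : ℂ, ‖x‖ < ‖z0‖ → ‖w x‖ < 1 := by
    intro x hx
    by_contra h
    push Not at h
    have : ‖z0‖ ≤ ‖x‖ := hmin ⟨by
      rw [mem_closedBall_zero_iff] at hz0 ⊢; linarith, h⟩
    linarith
  have hz0ne : z0 ≠ 0 := by
    rintro rfl
    simp [hw0] at hz0'
    linarith
  have hrpos : 0 < ‖z0‖ := norm_pos_iff.2 hz0ne
  have hle : ∀ x : ℂ, ‖x‖ = ‖z0‖ → ‖w x‖ ≤ 1 := by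
    intro x hx
    have hxb : x ∈ ball (0:ℂ) 1 := by rw [mem_ball_zero_iff, hx]; exact hr1
    have hcx : ContinuousAt w x := (hw.differentiableAt (isOpen_ball.mem_nhds hxb)).continuousAt
    have ht : Tendsto (fun t : ℝ => ‖w (t * x)‖) (𝓝[<] 1) (𝓝 ‖w x‖) := by
      apply Tendsto.norm
      have : Tendsto (fun t : ℝ => (t:ℂ) * x) (𝓝 1) (𝓝 x) := by
        have : Continuous (fun t : ℝ => (t:ℂ) * x) := by fun_prop
        simpa using this.tendsto 1
      exact (hcx.tendsto.comp this).mono_left nhdsWithin_le_nhds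
    refine le_of_tendsto ht ?_
    filter_upwards [Ioo_mem_nhdsLT (show (0:ℝ) < 1 by norm_num)] with t ht
    apply le_of_lt
    apply hlt
    rw [norm_mul, Complex.norm_real, Real.norm_of_nonneg ht.1.le, hx]
    nlinarith [ht.2]
  have h1 : ‖w z0‖ = 1 := le_antisymm (hle z0 rfl) hz0'
  have hdz0 : HasDerivAt w (deriv w z0) (z0 * 1) := by
    rw [mul_one]; exact (hw.differentiableAt (isOpen_ball.mem_nhds hz0b)).hasDerivAt
  have hm : ∀ x : ℂ, HasDerivAt (fun y => z0 * y) z0 x := fun x => by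
    simpa using (hasDerivAt_id x).const_mul z0
  have hd0 : HasDerivAt w a (z0 * 0) := by
    rw [mul_zero, ← hda]; exact (hw.differentiableAt (ball_mem_nhds _ one_pos)).hasDerivAt
  have hdv0 : deriv (fun ζ => w (z0 * ζ)) 0 = a * z0 := (hd0.comp _ (hm 0)).deriv
  obtain ⟨k, hk, hkd⟩ := aux_jack_s9 (fun ζ => w (z0 * ζ))
    (hw.comp (by fun_prop) (by
      intro x hx
      rw [mem_ball_zero_iff] at hx ⊢
      rw [norm_mul]; nlinarith [norm_nonneg x]))
    (by
      intro x hx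
      rw [mem_ball_zero_iff] at hx
      apply hlt
      rw [norm_mul]; nlinarith [norm_nonneg x])
    (by simp [hw0]) (a * ‖z0‖)
    (by rw [hdv0, norm_mul, Complex.norm_real, Real.norm_of_nonneg ha0]) (by nlinarith)
    (by intro x hx; apply hle; rw [norm_mul, hx, mul_one])
    (deriv w z0 * z0) (hdz0.comp _ (hm 1)) (by simpa using h1)
  simp only [mul_one] at hkd
  have hk2 : 2 / (1 + a) ≤ k := by
    refine le_trans ?_ hk
    apply div_le_div_of_nonneg_left (by norm_num) (by positivity)
    nlinarith
  have h3 := hre z0 hz0b hz0ne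
  rw [mul_comm z0, hkd] at h3
  have hne1 : (1 - w z0) ≠ 0 := sub_ne_zero.2 (Ne.symm (hne z0 hz0b))
  have h4 : (w z0 / (1 - w z0)).re = -1/2 := by
    have hn : Complex.normSq (w z0) = 1 := by rw [Complex.normSq_eq_norm_sq, h1]; simp
    have hn2 : Complex.normSq (1 - w z0) ≠ 0 := by simpa using hne1
    rw [Complex.div_re, ← add_div, div_eq_iff hn2]
    rw [Complex.normSq_apply] at hn ⊢
    simp
    linarith
  rw [mul_div_assoc, Complex.re_ofReal_mul, h4] at h3
  have : -1 / (1 + a) = -(2 / (1+a)) / 2 := by ring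
  linarith

/-- Corollary 3.6: for `f ∈ 𝒜_{p,b}` with `0 ≤ (p+1)b ≤ 2p`,
`Re(1 + z f''/f') > p - 4p/(2p+(p+1)b)` on the punctured disk implies
`Re √(f'(z)/(p z^(p-1))) > 1/2` on the disk. -/
theorem stmt_9 (p : ℕ) (hp : 1 ≤ p) (b : ℝ)
    (hb0 : 0 ≤ ((p : ℝ) + 1) * b) (hb1 : ((p : ℝ) + 1) * b ≤ 2 * (p : ℝ))
    (f g : ℂ → ℂ) (hg : DifferentiableOn ℂ g (Metric.ball 0 1)) (hg0 : g 0 = 1)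
    (hgb : deriv g 0 = (b : ℂ))
    (hfg : ∀ z ∈ Metric.ball (0 : ℂ) 1, f z = z ^ p * g z)
    (hf' : ∀ z ∈ Metric.ball (0 : ℂ) 1, z ≠ 0 → deriv f z ≠ 0)
    (hconv : ∀ z ∈ Metric.ball (0 : ℂ) 1, z ≠ 0 →
      (p : ℝ) - 4 * (p : ℝ) / (2 * (p : ℝ) + ((p : ℝ) + 1) * b) <
        (1 + z * deriv (deriv f) z / deriv f z).re)
    (s : ℂ → ℂ) (hs : DifferentiableOn ℂ s (Metric.ball 0 1)) (hs0 : s 0 = 1)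
    (hs2 : ∀ z ∈ Metric.ball (0 : ℂ) 1, z ≠ 0 →
      (s z) ^ 2 = deriv f z / ((p : ℂ) * z ^ (p - 1))) :
    ∀ z ∈ Metric.ball (0 : ℂ) 1, 1 / 2 < (s z).re := by
  obtain ⟨n, rfl⟩ : ∃ n, p = n + 1 := ⟨p - 1, by omega⟩
  simp only [Nat.add_sub_cancel] at hs2
  have hpR : (0:ℝ) < ((n + 1 : ℕ) : ℝ) := by positivity
  have hpC : ((n + 1 : ℕ) : ℂ) ≠ 0 := by exact_mod_cast Nat.succ_ne_zero n
  generalize hP : (((n + 1 : ℕ) : ℝ)) = P at *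
  have hPC : ((n + 1 : ℕ) : ℂ) = (P : ℂ) := by rw [← hP]; push_cast; ring
  have hnC : (n : ℂ) = P - 1 := by rw [← hPC]; push_cast; ring
  rw [hPC] at hpC hs2
  have hsd : ∀ z ∈ ball (0:ℂ) 1, HasDerivAt s (deriv s z) z := fun z hz =>
    (hs.differentiableAt (isOpen_ball.mem_nhds hz)).hasDerivAt
  have hgd : ∀ z ∈ ball (0:ℂ) 1, HasDerivAt g (deriv g z) z := fun z hz =>
    (hg.differentiableAt (isOpen_ball.mem_nhds hz)).hasDerivAt
  have h0 : (0:ℂ) ∈ ball (0:ℂ) 1 := by simp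
  have hfeq : ∀ z ∈ ball (0:ℂ) 1, z ≠ 0 → deriv f z = P * z ^ n * (s z) ^ 2 := by
    intro z hz hz0
    rw [hs2 z hz hz0]
    field_simp
  have hsne : ∀ z ∈ ball (0:ℂ) 1, s z ≠ 0 := by
    intro z hz h
    rcases eq_or_ne z 0 with rfl | hz0
    · simp [h] at hs0
    · apply hf' z hz hz0
      rw [hfeq z hz hz0, h]; simp
  have hsg : ∀ z ∈ ball (0:ℂ) 1, (s z) ^ 2 = g z + z * deriv g z / P := by
    intro z hz
    rcases eq_or_ne z 0 with rfl | hz0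
    · simp [hs0, hg0]
    · rw [hs2 z hz hz0]
      have e : f =ᶠ[𝓝 z] fun y => y ^ (n + 1) * g y := by
        filter_upwards [isOpen_ball.mem_nhds hz] with y hy using hfg y hy
      have e5 : deriv (fun y => y ^ (n + 1) * g y) z = _ :=
        ((hasDerivAt_pow (n+1) z).mul (hgd z hz)).deriv
      rw [e.deriv_eq, e5]
      rw [Nat.add_sub_cancel, hPC]
      field_simp
      try ring
  have hds0 : deriv s 0 = (((P + 1) * b / (2 * P) : ℝ) : ℂ) := by
    have e : (fun z => s z ^ 2) =ᶠ[𝓝 0] fun z => g z + z * deriv g z / P := by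
      filter_upwards [isOpen_ball.mem_nhds h0] with y hy using hsg y hy
    have e1 := ((hsd 0 h0).pow 2).deriv
    have hdd : HasDerivAt (deriv g) (deriv (deriv g) 0) 0 :=
      ((hg.deriv isOpen_ball).differentiableAt (isOpen_ball.mem_nhds h0)).hasDerivAt
    have e2 := ((hgd 0 h0).add (((hasDerivAt_id (0:ℂ)).mul hdd).div_const (P:ℂ))).deriv
    have e3 := e.deriv_eq
    have e4 : 2 * deriv s 0 = b + b / P := by
      have l : deriv (fun z => s z ^ 2) 0 = 2 * deriv s 0 := by
        refine e1.trans ?_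
        simp [hs0]
      have r : deriv (fun z => g z + z * deriv g z / P) 0 = b + b / P := by
        refine e2.trans ?_
        simp [hgb]
      rw [← l, ← r, e3]
    push_cast
    field_simp at e4 ⊢
    linear_combination e4
  have hfre : ∀ z ∈ ball (0:ℂ) 1, z ≠ 0 →
      z * deriv (deriv f) z / deriv f z = (P - 1) + 2 * (z * deriv s z / s z) := by
    intro z hz hz0
    have e : deriv f =ᶠ[𝓝 z] fun y => P * y ^ n * (s y) ^ 2 := by
      filter_upwards [isOpen_ball.mem_nhds hz, isOpen_ne.mem_nhds hz0] with y hy hy0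
        using hfeq y hy hy0
    have hd : deriv (deriv f) z = P * (n * z ^ (n - 1)) * s z ^ 2
        + P * z ^ n * (2 * s z * deriv s z) := by
      rw [e.deriv_eq]
      refine ((((hasDerivAt_pow n z).const_mul (P:ℂ)).mul ((hsd z hz).pow 2)).deriv).trans ?_
      simp
    have hzn : z * (n * z ^ (n - 1)) = n * z ^ n := by
      cases n with
      | zero => simp
      | succ m => rw [Nat.add_sub_cancel, pow_succ]; ring
    have hsz := hsne z hz
    rw [hd, hfeq z hz hz0, ← hnC, div_eq_iff (by positivity)]
    field_simp
    linear_combination (s z) * hzn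
  set a : ℝ := (P + 1) * b / (2 * P) with ha
  have hwd : ∀ z ∈ ball (0:ℂ) 1, HasDerivAt (fun z => 1 - (s z)⁻¹) (deriv s z / s z ^ 2) z := by
    intro z hz
    refine (((hsd z hz).inv (hsne z hz)).const_sub 1).congr_deriv ?_
    ring
  have main := aux_main (fun z => 1 - (s z)⁻¹)
    (fun z hz => (hwd z hz).differentiableAt.differentiableWithinAt) (by simp [hs0])
    a (by positivity) (by rw [ha, div_le_one (by positivity)]; exact hb1)
    (by rw [(hwd 0 h0).deriv, hs0, hds0]; simp)
    (by
      intro z hz h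
      have := hsne z hz
      simp [this] at h)
    (by
      intro z hz hz0
      have h1 := hconv z hz hz0
      have hsz := hsne z hz
      rw [hfre z hz hz0] at h1
      have e : z * (deriv s z / s z ^ 2) / (1 - (1 - (s z)⁻¹)) = z * deriv s z / s z := by
        rw [sub_sub_cancel]
        field_simp
      rw [(hwd z hz).deriv, e]
      have e2 : 4 * P / (2 * P + (P + 1) * b) = 2 * (1 / (1 + a)) := by
        have h5 : (P + 1) * b = a * (2 * P) := by rw [ha]; field_simp
        have h6 : 0 ≤ a := by positivity
        have : 1 + a ≠ 0 := by positivity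
        rw [h5]
        have : 2 * P + a * (2 * P) ≠ 0 := by positivity
        field_simp
        try ring
      rw [e2] at h1
      have e3 : (1 + ((P:ℂ) - 1 + 2 * (z * deriv s z / s z))).re
          = P + 2 * (z * deriv s z / s z).re := by
        simp
        ring
      rw [e3] at h1
      rw [neg_div]
      linarith)
  intro z hz
  have h1 := main z hz
  have hsz := hsne z hz
  have e : 1 - (s z)⁻¹ = (s z - 1) / s z := by field_simp
  rw [e, norm_div, div_lt_one (norm_pos_iff.2 hsz)] at h1
  have h2 := pow_lt_pow_left₀ h1 (norm_nonneg _) (two_ne_zero)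
  rw [← Complex.normSq_eq_norm_sq, ← Complex.normSq_eq_norm_sq, Complex.normSq_apply,
    Complex.normSq_apply] at h2
  simp at h2
  linarith
end
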